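/- arXiv:1210.0124 — 2 statements merged into one kernel-verified Lean document; each statement's English description precedes it below -/
import Mathlib

section
/- Let n ≥ 2, let α ∈ ℝ, let Π ⊂ ℝⁿ be a box, and let F, G : Π → ℝⁿ be vector fields each of whose components is a checkered function on Π. Suppose U, W : closure(Π) → ℝⁿ are continuously differentiable on closure(Π) and satisfy ΔU + α·grad div U = F and ΔW + α·grad div W = G in the distributional sense on the interior of Π (i.e. ∫ ⟨U, Δφ + α·grad div φ⟩ dx = ∫ ⟨F, φ⟩ dx for every smooth compactly supported vector field φ on the interior of Π, and likewise for W and G). If U(x) = W(x) for every x ∈ ∂Π, and σ(U)(x)·ν = σ(W)(x)·ν for every x in the relative interior of each (n−1)-dimensional face of Π, where ν is the outward unit normal to that face, then F = G almost everywhere on Π. -/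
open MeasureTheory

noncomputable section

/-- The half-open box `[a₁,b₁) × ⋯ × [aₙ,bₙ)` in `ℝⁿ`. -/
def box {n : ℕ} (a b : Fin n → ℝ) : Set (Fin n → ℝ) :=
  Set.univ.pi fun i => Set.Ico (a i) (b i)

/-- A function is checkered on `P` if it is a finite linear combination of
characteristic functions of boxes contained in `P`. -/
def Checkered {n : ℕ} (P : Set (Fin n → ℝ)) (f : (Fin n → ℝ) → ℝ) : Prop :=
  ∃ (N : ℕ) (c : Fin N → ℝ) (lo hi : Fin N → Fin n → ℝ),
    (∀ k i, lo k i < hi k i) ∧ (∀ k, box (lo k) (hi k) ⊆ P) ∧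
    f = fun x => ∑ k, c k * Set.indicator (box (lo k) (hi k)) (fun _ => (1:ℝ)) x

/-- Partial derivative `∂f/∂xᵢ`. -/
def pd {n : ℕ} (f : (Fin n → ℝ) → ℝ) (i : Fin n) (x : Fin n → ℝ) : ℝ :=
  fderiv ℝ f x (Pi.single i 1)

/-- Componentwise Laplacian of a vector field. -/
def vlap {n : ℕ} (U : (Fin n → ℝ) → Fin n → ℝ) (x : Fin n → ℝ) (i : Fin n) : ℝ :=
  ∑ j, pd (fun y => pd (fun z => U z i) j y) j x

/-- Divergence of a vector field. -/
def divg {n : ℕ} (U : (Fin n → ℝ) → Fin n → ℝ) (x : Fin n → ℝ) : ℝ :=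
  ∑ i, pd (fun z => U z i) i x

/-- `grad div` of a vector field. -/
def gradDiv {n : ℕ} (U : (Fin n → ℝ) → Fin n → ℝ) (x : Fin n → ℝ) (i : Fin n) : ℝ :=
  pd (divg U) i x

/-- Partial derivative within a set. -/
def pdW {n : ℕ} (s : Set (Fin n → ℝ)) (f : (Fin n → ℝ) → ℝ) (i : Fin n)
    (x : Fin n → ℝ) : ℝ :=
  fderivWithin ℝ f s x (Pi.single i 1)

/-- Stress tensor `σᵢⱼ(U) = (α−1)·δᵢⱼ·div U + ∂Uᵢ/∂xⱼ + ∂Uⱼ/∂xᵢ`, with the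
derivatives taken within the set `s`. -/
def stress {n : ℕ} (α : ℝ) (s : Set (Fin n → ℝ)) (U : (Fin n → ℝ) → Fin n → ℝ)
    (x : Fin n → ℝ) (i j : Fin n) : ℝ :=
  (α - 1) * (if i = j then 1 else 0) * (∑ k, pdW s (fun z => U z k) k x)
    + pdW s (fun z => U z i) j x + pdW s (fun z => U z j) i x

section PartialDerivatives

variable {n : ℕ}

theorem pd_eq_of_hasDerivAt_update {f : (Fin n → ℝ) → ℝ} {x : Fin n → ℝ} {j : Fin n} {d : ℝ}
    (hf : DifferentiableAt ℝ f x)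
    (hd : HasDerivAt (fun s => f (Function.update x j s)) d (x j)) : pd f j x = d := by
  have h1 : HasFDerivAt f (fderiv ℝ f x) (Function.update x j (x j)) := by
    simpa using hf.hasFDerivAt
  exact (h1.comp_hasDerivAt (x j) (hasDerivAt_update x j (x j))).unique hd

theorem ContDiff.pd {f : (Fin n → ℝ) → ℝ} (hf : ContDiff ℝ (⊤ : ℕ∞) f) (j : Fin n) :
    ContDiff ℝ (⊤ : ℕ∞) (pd f j) :=
  (hf.fderiv_right (m := (⊤ : ℕ∞)) (by simp)).clm_apply contDiff_const

theorem ContDiff.differentiableAt_of_top {f : (Fin n → ℝ) → ℝ}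
    (hf : ContDiff ℝ (⊤ : ℕ∞) f) (x : Fin n → ℝ) : DifferentiableAt ℝ f x :=
  (hf.differentiable (by simp)) x

theorem pd_mul {f g : (Fin n → ℝ) → ℝ} (hf : ContDiff ℝ (⊤ : ℕ∞) f)
    (hg : ContDiff ℝ (⊤ : ℕ∞) g) (j : Fin n) :
    pd (fun x => f x * g x) j = fun x => pd f j x * g x + f x * pd g j x := by
  funext x
  simp only [pd]
  rw [fderiv_fun_mul (hf.differentiableAt_of_top x) (hg.differentiableAt_of_top x)]
  simp
  ring

theorem pd_add {f g : (Fin n → ℝ) → ℝ} (hf : ContDiff ℝ (⊤ : ℕ∞) f)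
    (hg : ContDiff ℝ (⊤ : ℕ∞) g) (j : Fin n) :
    pd (fun x => f x + g x) j = fun x => pd f j x + pd g j x := by
  funext x
  simp only [pd]
  rw [fderiv_fun_add (hf.differentiableAt_of_top x) (hg.differentiableAt_of_top x)]
  simp

theorem pd_sum {ι : Type*} {s : Finset ι} {f : ι → (Fin n → ℝ) → ℝ}
    (hf : ∀ k, ContDiff ℝ (⊤ : ℕ∞) (f k)) (j : Fin n) :
    pd (fun x => ∑ k ∈ s, f k x) j = fun x => ∑ k ∈ s, pd (f k) j x := by
  funext x
  simp only [pd]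
  rw [fderiv_fun_sum fun k _ => (hf k).differentiableAt_of_top x]
  simp

/-- Second-order product rule for partial derivatives. -/
theorem pd_pd_mul {f g : (Fin n → ℝ) → ℝ} (hf : ContDiff ℝ (⊤ : ℕ∞) f)
    (hg : ContDiff ℝ (⊤ : ℕ∞) g) (j k : Fin n) (x : Fin n → ℝ) :
    pd (pd (fun x => f x * g x) j) k x =
      pd (pd f j) k x * g x + pd f j x * pd g k x + pd f k x * pd g j x
        + f x * pd (pd g j) k x := by
  rw [pd_mul hf hg, pd_add ((hf.pd j).mul hg) (hf.mul (hg.pd j)), pd_mul (hf.pd j) hg,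
    pd_mul hf (hg.pd j)]
  ring

/-- The elasticity operator applied to a scalar multiple `χ φ` of a vector field. -/
theorem vlap_add_gradDiv_mul (α : ℝ) {χ : (Fin n → ℝ) → ℝ} {φ : (Fin n → ℝ) → Fin n → ℝ}
    (hχ : ContDiff ℝ (⊤ : ℕ∞) χ) (hφ : ∀ k, ContDiff ℝ (⊤ : ℕ∞) fun x => φ x k)
    (x : Fin n → ℝ) (k : Fin n) :
    vlap (fun y i => χ y * φ y i) x k + α * gradDiv (fun y i => χ y * φ y i) x k =
      χ x * (vlap φ x k + α * gradDiv φ x k)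
        + ∑ j, (pd (pd χ j) j x * φ x k + 2 * (pd χ j x * pd (fun y => φ y k) j x)
          + α * (pd (pd χ j) k x * φ x j + pd χ j x * pd (fun y => φ y j) k x
            + pd χ k x * pd (fun y => φ y j) j x)) := by
  have hd : ∀ ψ : (Fin n → ℝ) → Fin n → ℝ, (∀ i, ContDiff ℝ (⊤ : ℕ∞) fun x => ψ x i) →
      gradDiv ψ x k = ∑ j, pd (pd (fun y => ψ y j) j) k x := by
    intro ψ hψ
    have := congrFun (pd_sum (s := Finset.univ) (fun j => (hψ j).pd j) k) x
    exact this
  rw [hd _ fun i => hχ.mul (hφ i), hd _ hφ]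
  have hv : ∀ ψ : (Fin n → ℝ) → Fin n → ℝ,
      vlap ψ x k = ∑ j, pd (pd (fun y => ψ y k) j) j x := fun ψ => rfl
  rw [hv, hv]
  simp only [pd_pd_mul hχ (hφ _), Finset.mul_sum, ← Finset.sum_add_distrib]
  refine Finset.sum_congr rfl fun j _ => ?_
  ring

end PartialDerivatives

section Cutoff

/-- A smooth cutoff which vanishes near and outside the endpoints of `[a, b]` and equals `1` at
distance at least `2 * ε` from them. -/
def cutoff (a b ε s : ℝ) : ℝ :=
  Real.smoothTransition (ε⁻¹ * (s - a) - 1) * Real.smoothTransition (ε⁻¹ * (b - s) - 1)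

/-- The points at distance at most `2 * ε` from the endpoints of `[a, b]`, or outside of it. -/
def layer (a b ε : ℝ) : Set ℝ := {s | s ≤ a + 2 * ε ∨ b - 2 * ε ≤ s}

theorem contDiff_cutoff (a b ε : ℝ) : ContDiff ℝ (⊤ : ℕ∞) (cutoff a b ε) := by
  unfold cutoff
  refine ContDiff.mul (Real.smoothTransition.contDiff.comp ?_)
    (Real.smoothTransition.contDiff.comp ?_) <;> fun_prop

theorem cutoff_nonneg (a b ε s : ℝ) : 0 ≤ cutoff a b ε s :=
  mul_nonneg (Real.smoothTransition.nonneg _) (Real.smoothTransition.nonneg _)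

theorem cutoff_le_one (a b ε s : ℝ) : cutoff a b ε s ≤ 1 :=
  mul_le_one₀ (Real.smoothTransition.le_one _) (Real.smoothTransition.nonneg _)
    (Real.smoothTransition.le_one _)

theorem cutoff_eq_zero {a b ε s : ℝ} (hε : 0 < ε) (hs : s ∉ Set.Icc (a + ε) (b - ε)) :
    cutoff a b ε s = 0 := by
  unfold cutoff
  by_cases h : s < a + ε
  · rw [Real.smoothTransition.zero_of_nonpos, zero_mul]
    rw [sub_nonpos, inv_mul_le_iff₀ hε]
    linarith
  · rw [Real.smoothTransition.zero_of_nonpos (x := ε⁻¹ * (b - s) - 1), mul_zero]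
    rw [sub_nonpos, inv_mul_le_iff₀ hε]
    have : ¬ s ≤ b - ε := fun h' => hs ⟨not_lt.mp h, h'⟩
    linarith

theorem cutoff_eq_one {a b ε s : ℝ} (hε : 0 < ε) (hs : s ∉ layer a b ε) :
    cutoff a b ε s = 1 := by
  simp only [layer, Set.mem_ofPred_eq, not_or, not_le] at hs
  unfold cutoff
  rw [Real.smoothTransition.one_of_one_le, Real.smoothTransition.one_of_one_le, one_mul]
  all_goals
    rw [le_sub_iff_add_le, le_inv_mul_iff₀ hε]
    linarith

theorem isClosed_layer (a b ε : ℝ) : IsClosed (layer a b ε) :=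
  isClosed_Iic.union isClosed_Ici

theorem iteratedDeriv_cutoff_eq_zero {a b ε s : ℝ} (hε : 0 < ε) (hs : s ∉ layer a b ε)
    {m : ℕ} (hm : m ≠ 0) : iteratedDeriv m (cutoff a b ε) s = 0 := by
  have h : cutoff a b ε =ᶠ[nhds s] fun _ => (1 : ℝ) := by
    filter_upwards [(isClosed_layer a b ε).isOpen_compl.mem_nhds hs] with t ht
    exact cutoff_eq_one hε ht
  rw [h.iteratedDeriv_eq, iteratedDeriv_const, if_neg hm]

theorem exists_bound_iteratedDeriv_smoothTransition (m : ℕ) :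
    ∃ C, ∀ t, |iteratedDeriv m Real.smoothTransition t| ≤ C := by
  have hc : Continuous (iteratedDeriv m Real.smoothTransition) :=
    (Real.smoothTransition.contDiff (n := m)).continuous_iteratedDeriv m le_rfl
  obtain ⟨C, hC⟩ := (isCompact_Icc (a := (0 : ℝ)) (b := 1)).exists_bound_of_continuousOn
    hc.continuousOn
  refine ⟨max C 1, fun t => ?_⟩
  by_cases ht : t ∈ Set.Icc (0 : ℝ) 1
  · exact (hC t ht).trans (le_max_left _ _)
  · refine le_trans ?_ (le_max_right _ _)
    have key : ∃ c : ℝ, |c| ≤ 1 ∧ Real.smoothTransition =ᶠ[nhds t] fun _ => c := by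
      rcases lt_or_ge t 0 with h | h
      · refine ⟨0, by simp, ?_⟩
        filter_upwards [Iio_mem_nhds h] with s hs
        exact Real.smoothTransition.zero_of_nonpos (le_of_lt hs)
      · refine ⟨1, by simp, ?_⟩
        have h1 : 1 < t := by
          by_contra h'
          exact ht ⟨h, not_lt.mp h'⟩
        filter_upwards [Ioi_mem_nhds h1] with s hs
        exact Real.smoothTransition.one_of_one_le (le_of_lt hs)
    obtain ⟨c, hc1, hc⟩ := key
    rw [hc.iteratedDeriv_eq, iteratedDeriv_const]
    split_ifs <;> simp [hc1]

theorem exists_bound_iteratedDeriv_cutoff (m : ℕ) :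
    ∃ C, ∀ a b ε s, 0 < ε → |iteratedDeriv m (cutoff a b ε) s| ≤ C * (ε⁻¹) ^ m := by
  choose C hC using exists_bound_iteratedDeriv_smoothTransition
  refine ⟨∑ i ∈ Finset.range (m + 1), m.choose i * C i * C (m - i), fun a b ε s hε => ?_⟩
  have hT : ContDiff ℝ m Real.smoothTransition := Real.smoothTransition.contDiff
  have e1 : ∀ i : ℕ, i ≤ m → ∀ t,
      iteratedDeriv i (fun s => Real.smoothTransition (ε⁻¹ * (s - a) - 1)) t
        = (ε⁻¹) ^ i * iteratedDeriv i Real.smoothTransition (ε⁻¹ * (t - a) - 1) := by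
    intro i hi t
    have := congrFun (iteratedDeriv_comp_const_mul (n := i)
      (f := fun z => Real.smoothTransition (z - (ε⁻¹ * a + 1)))
      (by exact (hT.of_le (by exact_mod_cast hi)).comp (by fun_prop)) ε⁻¹) t
    simp only [iteratedDeriv_comp_sub_const] at this
    have hf : (fun s => Real.smoothTransition (ε⁻¹ * (s - a) - 1)) =
        fun s => Real.smoothTransition (ε⁻¹ * s - (ε⁻¹ * a + 1)) := by
      funext s
      congr 1
      ring
    rw [hf, this]
    congr 2
    ring
  have e2 : ∀ i : ℕ, i ≤ m → ∀ t,
      iteratedDeriv i (fun s => Real.smoothTransition (ε⁻¹ * (b - s) - 1)) t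
        = (-ε⁻¹) ^ i * iteratedDeriv i Real.smoothTransition (ε⁻¹ * (b - t) - 1) := by
    intro i hi t
    have := congrFun (iteratedDeriv_comp_const_mul (n := i)
      (f := fun z => Real.smoothTransition (z - (1 - ε⁻¹ * b)))
      (by exact (hT.of_le (by exact_mod_cast hi)).comp (by fun_prop)) (-ε⁻¹)) t
    simp only [iteratedDeriv_comp_sub_const] at this
    have hf : (fun s => Real.smoothTransition (ε⁻¹ * (b - s) - 1)) =
        fun s => Real.smoothTransition (-ε⁻¹ * s - (1 - ε⁻¹ * b)) := by
      funext s
      congr 1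
      ring
    rw [hf, this]
    congr 2
    ring
  have hmul := iteratedDeriv_fun_mul (n := m) (x := s)
    (f := fun s => Real.smoothTransition (ε⁻¹ * (s - a) - 1))
    (g := fun s => Real.smoothTransition (ε⁻¹ * (b - s) - 1))
    (ContDiff.contDiffAt (hT.comp (by fun_prop))) (ContDiff.contDiffAt (hT.comp (by fun_prop)))
  have : iteratedDeriv m (cutoff a b ε) s = _ := hmul
  rw [this, Finset.sum_mul]
  refine (Finset.abs_sum_le_sum_abs _ _).trans (Finset.sum_le_sum fun i hi => ?_)
  have hi' : i ≤ m := Nat.lt_succ_iff.mp (Finset.mem_range.mp hi)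
  rw [e1 i hi', e2 (m - i) (Nat.sub_le _ _)]
  have hε' : 0 < ε⁻¹ := inv_pos.mpr hε
  simp only [abs_mul, abs_pow, abs_neg, abs_of_pos hε', Nat.abs_cast]
  have hp : (ε⁻¹) ^ m = (ε⁻¹) ^ i * (ε⁻¹) ^ (m - i) := by
    rw [← pow_add, Nat.add_sub_cancel' hi']
  rw [hp]
  have h1 := hC i (ε⁻¹ * (s - a) - 1)
  have h2 := hC (m - i) (ε⁻¹ * (b - s) - 1)
  have h0 : 0 ≤ C i := (abs_nonneg _).trans h1
  calc _ = (m.choose i : ℝ) * (|iteratedDeriv i Real.smoothTransition (ε⁻¹ * (s - a) - 1)| *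
        |iteratedDeriv (m - i) Real.smoothTransition (ε⁻¹ * (b - s) - 1)|) *
        ((ε⁻¹) ^ i * (ε⁻¹) ^ (m - i)) := by ring
    _ ≤ (m.choose i : ℝ) * (C i * C (m - i)) * ((ε⁻¹) ^ i * (ε⁻¹) ^ (m - i)) := by gcongr
    _ = _ := by ring

variable {n : ℕ}

/-- Mixed derivatives, of order `m i` in the `i`-th variable, of the product of cutoffs. -/
def boxCutoff (a b : Fin n → ℝ) (ε : ℝ) (m : Fin n → ℕ) (x : Fin n → ℝ) : ℝ :=
  ∏ i, iteratedDeriv (m i) (cutoff (a i) (b i) ε) (x i)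

theorem contDiff_boxCutoff (a b : Fin n → ℝ) (ε : ℝ) (m : Fin n → ℕ) :
    ContDiff ℝ (⊤ : ℕ∞) (boxCutoff a b ε m) := by
  unfold boxCutoff
  refine contDiff_prod fun i _ => ?_
  have : ContDiff ℝ (⊤ : ℕ∞) (iteratedDeriv (m i) (cutoff (a i) (b i) ε)) := by
    rw [iteratedDeriv_eq_iterate]
    exact (contDiff_cutoff _ _ _).iterate_deriv _
  exact this.comp (contDiff_apply ℝ ℝ i)

theorem pd_boxCutoff (a b : Fin n → ℝ) (ε : ℝ) (m : Fin n → ℕ) (j : Fin n) :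
    pd (boxCutoff a b ε m) j = boxCutoff a b ε (m + Pi.single j 1) := by
  funext x
  refine pd_eq_of_hasDerivAt_update ((contDiff_boxCutoff a b ε m).differentiableAt_of_top x) ?_
  have h1 : ∀ s, boxCutoff a b ε m (Function.update x j s) =
      iteratedDeriv (m j) (cutoff (a j) (b j) ε) s *
        ∏ i ∈ Finset.univ.erase j, iteratedDeriv (m i) (cutoff (a i) (b i) ε) (x i) := by
    intro s
    rw [boxCutoff, ← Finset.mul_prod_erase _ _ (Finset.mem_univ j)]
    congr 1
    · simp
    · refine Finset.prod_congr rfl fun i hi => ?_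
      rw [Function.update_of_ne (Finset.ne_of_mem_erase hi)]
  have h2 : boxCutoff a b ε (m + Pi.single j 1) x =
      iteratedDeriv (m j + 1) (cutoff (a j) (b j) ε) (x j) *
        ∏ i ∈ Finset.univ.erase j, iteratedDeriv (m i) (cutoff (a i) (b i) ε) (x i) := by
    rw [boxCutoff, ← Finset.mul_prod_erase _ _ (Finset.mem_univ j)]
    congr 1
    · simp
    · refine Finset.prod_congr rfl fun i hi => ?_
      simp [Finset.ne_of_mem_erase hi]
  simp only [h1]
  rw [h2]
  refine HasDerivAt.mul_const ?_ _
  rw [iteratedDeriv_succ]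
  have : ContDiff ℝ (⊤ : ℕ∞) (iteratedDeriv (m j) (cutoff (a j) (b j) ε)) := by
    rw [iteratedDeriv_eq_iterate]
    exact (contDiff_cutoff _ _ _).iterate_deriv _
  exact ((this.differentiable (by simp)) (x j)).hasDerivAt

theorem exists_bound_boxCutoff (a b : Fin n → ℝ) (m : Fin n → ℕ) :
    ∃ C, 0 ≤ C ∧ ∀ ε x, 0 < ε → |boxCutoff a b ε m x| ≤ C * (ε⁻¹) ^ (∑ i, m i) *
      ∏ j ∈ Finset.univ.filter (fun i => m i ≠ 0),
        Set.indicator (layer (a j) (b j) ε) (fun _ => (1 : ℝ)) (x j) := by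
  choose C hC using exists_bound_iteratedDeriv_cutoff
  have hC0 : ∀ m, 0 ≤ C m := fun m => by
    have := (abs_nonneg _).trans (hC m 0 0 1 0 one_pos)
    simpa using this
  refine ⟨∏ i, C (m i), Finset.prod_nonneg fun i _ => hC0 _, fun ε x hε => ?_⟩
  rw [boxCutoff, Finset.abs_prod, ← Finset.prod_pow_eq_pow_sum, Finset.prod_filter,
    ← Finset.prod_mul_distrib, ← Finset.prod_mul_distrib]
  refine Finset.prod_le_prod (fun i _ => abs_nonneg _) fun i _ => ?_
  split_ifs with hm
  · by_cases hx : x i ∈ layer (a i) (b i) ε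
    · simpa [hx] using hC (m i) (a i) (b i) ε (x i) hε
    · simp [hx, iteratedDeriv_cutoff_eq_zero hε hx hm]
  · simpa using hC (m i) (a i) (b i) ε (x i) hε

end Cutoff

section LayerIntegrals

open Filter Topology

variable {n : ℕ}

/-- The interior of the box with corners `a` and `b`. -/
def openBox (a b : Fin n → ℝ) : Set (Fin n → ℝ) :=
  Set.univ.pi fun i => Set.Ioo (a i) (b i)

theorem measurableSet_openBox (a b : Fin n → ℝ) : MeasurableSet (openBox a b) :=
  MeasurableSet.univ_pi fun _ => measurableSet_Ioo

theorem openBox_subset_Icc (a b : Fin n → ℝ) : openBox a b ⊆ Set.Icc a b := fun _ hx =>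
  ⟨fun i => (hx i trivial).1.le, fun i => (hx i trivial).2.le⟩

theorem volume_openBox_lt_top (a b : Fin n → ℝ) : volume (openBox a b) < ⊤ :=
  (measure_mono (openBox_subset_Icc a b)).trans_lt isCompact_Icc.measure_lt_top

theorem setIntegral_indicator_layer_le {a b ε : ℝ} (hε : 0 < ε) :
    ∫ s in Set.Ioo a b, Set.indicator (layer a b ε) (fun _ => (1 : ℝ)) s ≤ 4 * ε := by
  rw [integral_indicator (isClosed_layer a b ε).measurableSet, setIntegral_const, smul_eq_mul,
    mul_one, Measure.real, Measure.restrict_apply (isClosed_layer a b ε).measurableSet]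
  have hsub : layer a b ε ∩ Set.Ioo a b ⊆
      Set.Ioc a (a + 2 * ε) ∪ Set.Ico (b - 2 * ε) b := by
    rintro s ⟨h | h, hs⟩
    · exact Or.inl ⟨hs.1, h⟩
    · exact Or.inr ⟨h, hs.2⟩
  refine ENNReal.toReal_le_of_le_ofReal (by positivity) ?_
  refine (measure_mono hsub).trans ((measure_union_le _ _).trans ?_)
  rw [Real.volume_Ioc, Real.volume_Ico, ← ENNReal.ofReal_add (by linarith) (by linarith)]
  exact ENNReal.ofReal_le_ofReal (by linarith)

theorem integrable_prod_indicator_layer (a b : Fin n → ℝ) (ε : ℝ) (J : Finset (Fin n)) :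
    IntegrableOn (fun x : Fin n → ℝ =>
      ∏ j ∈ J, Set.indicator (layer (a j) (b j) ε) (fun _ => (1 : ℝ)) (x j)) (openBox a b) := by
  refine Measure.integrableOn_of_bounded (M := 1) (volume_openBox_lt_top a b).ne ?_ ?_
  · refine Measurable.aestronglyMeasurable ?_
    refine Finset.measurable_prod _ fun j _ => ?_
    exact (measurable_const.indicator (isClosed_layer _ _ _).measurableSet).comp
      (measurable_pi_apply j)
  · refine Eventually.of_forall fun x => ?_
    rw [norm_prod]
    refine Finset.prod_le_one (fun _ _ => norm_nonneg _) fun j _ => ?_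
    exact (norm_indicator_le_norm_self _ _).trans (by simp)

theorem setIntegral_prod_indicator_layer_le {a b : Fin n → ℝ} (hab : ∀ i, a i < b i) {ε : ℝ}
    (hε : 0 < ε) (J : Finset (Fin n)) :
    ∫ x in openBox a b, ∏ j ∈ J, Set.indicator (layer (a j) (b j) ε) (fun _ => (1 : ℝ)) (x j)
      ≤ (∏ i, (4 + (b i - a i))) * ε ^ J.card := by
  have h1 : ∀ x : Fin n → ℝ,
      ∏ j ∈ J, Set.indicator (layer (a j) (b j) ε) (fun _ => (1 : ℝ)) (x j) =
      ∏ i, (fun (i : Fin n) (s : ℝ) => if i ∈ J then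
        Set.indicator (layer (a i) (b i) ε) (fun _ => (1 : ℝ)) s else 1) i (x i) := by
    intro x
    rw [Finset.prod_ite_mem, Finset.univ_inter]
  rw [integral_congr_ae (Eventually.of_forall h1), openBox, volume_pi, Measure.restrict_pi_pi,
    integral_fintype_prod_eq_prod (E := fun _ => ℝ) (fun (i : Fin n) (s : ℝ) => if i ∈ J then
      Set.indicator (layer (a i) (b i) ε) (fun _ => (1 : ℝ)) s else 1)]
  have h2 : (∏ i, (4 + (b i - a i))) * ε ^ J.card =
      ∏ i, ((4 + (b i - a i)) * if i ∈ J then ε else 1) := by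
    rw [Finset.prod_mul_distrib, Finset.prod_ite_mem, Finset.univ_inter, Finset.prod_const]
  rw [h2]
  refine Finset.prod_le_prod (fun i _ => ?_) fun i _ => ?_
  · refine integral_nonneg fun s => ?_
    dsimp only
    split_ifs
    · exact Set.indicator_nonneg (fun _ _ => zero_le_one) _
    · exact zero_le_one
  · have := hab i
    split_ifs
    · refine (setIntegral_indicator_layer_le hε).trans ?_
      nlinarith
    · simp [this.le]

theorem tendsto_setIntegral_of_layer_bound {a b : Fin n → ℝ} (hab : ∀ i, a i < b i)
    (J : Finset (Fin n)) {g : ℝ → (Fin n → ℝ) → ℝ}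
    (hg : ∀ δ > 0, ∀ᶠ ε in 𝓝[>] (0 : ℝ), ∀ x ∈ openBox a b, |g ε x| ≤ δ * (ε⁻¹) ^ J.card *
      ∏ j ∈ J, Set.indicator (layer (a j) (b j) ε) (fun _ => (1 : ℝ)) (x j)) :
    Tendsto (fun ε => ∫ x in openBox a b, g ε x) (𝓝[>] 0) (𝓝 0) := by
  set M := ∏ i, (4 + (b i - a i)) with hM
  have hM0 : 0 < M := Finset.prod_pos fun i _ => by linarith [hab i]
  rw [Metric.tendsto_nhds]
  intro η hη
  filter_upwards [hg (η / (2 * M)) (by positivity), self_mem_nhdsWithin] with ε h hε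
  have hε : 0 < ε := hε
  rw [dist_zero_right]
  have h1 : ‖∫ x in openBox a b, g ε x‖ ≤ ∫ x in openBox a b, η / (2 * M) * (ε⁻¹) ^ J.card *
      ∏ j ∈ J, Set.indicator (layer (a j) (b j) ε) (fun _ => (1 : ℝ)) (x j) := by
    refine norm_integral_le_of_norm_le ((integrable_prod_indicator_layer a b ε J).const_mul _) ?_
    filter_upwards [ae_restrict_mem (measurableSet_openBox a b)] with x hx
    exact h x hx
  refine h1.trans_lt ?_
  rw [integral_const_mul]
  calc _ ≤ η / (2 * M) * (ε⁻¹) ^ J.card * (M * ε ^ J.card) := by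
        gcongr
        exact setIntegral_prod_indicator_layer_le hab hε J
    _ = η / 2 := by
        rw [inv_pow]
        field_simp
    _ < η := by linarith

end LayerIntegrals

section BoundaryBehaviour

open Filter Topology

variable {n : ℕ} {a b : Fin n → ℝ} {f : (Fin n → ℝ) → ℝ}

theorem uniqueDiffOn_Icc_pi (hab : ∀ i, a i < b i) : UniqueDiffOn ℝ (Set.Icc a b) := by
  rw [← Set.pi_univ_Icc]
  exact UniqueDiffOn.univ_pi fun i => uniqueDiffOn_Icc (hab i)

theorem update_mem_Icc_pi {x : Fin n → ℝ} (hx : x ∈ Set.Icc a b) {i : Fin n} {s : ℝ}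
    (hs : s ∈ Set.Icc (a i) (b i)) : Function.update x i s ∈ Set.Icc a b := by
  rw [← Set.pi_univ_Icc] at hx ⊢
  intro j _
  rcases eq_or_ne j i with rfl | h
  · simpa using hs
  · rw [Function.update_of_ne h]
    exact hx j trivial

theorem continuousOn_pdW (hab : ∀ i, a i < b i) (hf : ContDiffOn ℝ 1 f (Set.Icc a b))
    (i : Fin n) : ContinuousOn (pdW (Set.Icc a b) f i) (Set.Icc a b) :=
  (hf.continuousOn_fderivWithin (uniqueDiffOn_Icc_pi hab) le_rfl).clm_apply continuousOn_const

theorem hasDerivWithinAt_comp_update (hf : ContDiffOn ℝ 1 f (Set.Icc a b)) {x : Fin n → ℝ}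
    (hx : x ∈ Set.Icc a b) (i : Fin n) {t : ℝ} (ht : t ∈ Set.Icc (a i) (b i)) :
    HasDerivWithinAt (fun s => f (Function.update x i s))
      (pdW (Set.Icc a b) f i (Function.update x i t)) (Set.Icc (a i) (b i)) t :=
  ((hf.differentiableOn one_ne_zero) _
    (update_mem_Icc_pi hx ht)).hasFDerivWithinAt.comp_hasDerivWithinAt t
      (hasDerivAt_update x i t).hasDerivWithinAt fun _ hs => update_mem_Icc_pi hx hs

theorem abs_le_of_pdW_bound (hf : ContDiffOn ℝ 1 f (Set.Icc a b)) {x : Fin n → ℝ}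
    (hx : x ∈ Set.Icc a b) {i : Fin n} {e B : ℝ} (he : e ∈ Set.Icc (a i) (b i))
    (hfe : f (Function.update x i e) = 0)
    (hB : ∀ s ∈ Set.uIcc e (x i), |pdW (Set.Icc a b) f i (Function.update x i s)| ≤ B) :
    |f x| ≤ B * |x i - e| := by
  have hxi : x i ∈ Set.Icc (a i) (b i) := ⟨hx.1 i, hx.2 i⟩
  have hsub : Set.uIcc e (x i) ⊆ Set.Icc (a i) (b i) := Set.uIcc_subset_Icc he hxi
  have := Convex.norm_image_sub_le_of_norm_hasDerivWithin_le
    (f := fun s => f (Function.update x i s)) (C := B)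
    (fun s hs => (hasDerivWithinAt_comp_update hf hx i (hsub hs)).mono hsub) hB
    (convex_uIcc e (x i)) Set.left_mem_uIcc Set.right_mem_uIcc
  simpa [hfe] using this

theorem pdW_eq_zero_of_tangential (hab : ∀ i, a i < b i) (hf : ContDiffOn ℝ 1 f (Set.Icc a b))
    (h0 : ∀ x ∈ Set.Icc a b, (∃ i, x i = a i ∨ x i = b i) → f x = 0) {x : Fin n → ℝ}
    (hx : x ∈ Set.Icc a b) {i j : Fin n} (hi : x i = a i ∨ x i = b i) (hij : j ≠ i) :
    pdW (Set.Icc a b) f j x = 0 := by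
  have hxj : x j ∈ Set.Icc (a j) (b j) := ⟨hx.1 j, hx.2 j⟩
  have h1 := hasDerivWithinAt_comp_update hf hx j hxj
  have hz : ∀ s ∈ Set.Icc (a j) (b j), f (Function.update x j s) = 0 := fun s hs =>
    h0 _ (update_mem_Icc_pi hx hs) ⟨i, by rwa [Function.update_of_ne hij.symm]⟩
  have h2 : HasDerivWithinAt (fun s => f (Function.update x j s)) 0 (Set.Icc (a j) (b j)) (x j) :=
    (hasDerivWithinAt_const (x j) _ (0 : ℝ)).congr hz (hz _ hxj)
  rw [Function.update_eq_self] at h1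
  exact (uniqueDiffOn_Icc (hab j) _ hxj).eq_deriv _ h1 h2

theorem exists_face_near {x : Fin n → ℝ} (hx : x ∈ openBox a b) {i : Fin n} {ε : ℝ}
    (hl : x i ∈ layer (a i) (b i) ε) :
    ∃ e, (e = a i ∨ e = b i) ∧ e ∈ Set.Icc (a i) (b i) ∧ |x i - e| ≤ 2 * ε := by
  obtain ⟨h1, h2⟩ := hx i trivial
  rcases hl with h | h
  · refine ⟨a i, Or.inl rfl, ⟨le_rfl, (h1.trans h2).le⟩, ?_⟩
    rw [abs_of_pos (by linarith)]
    linarith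
  · refine ⟨b i, Or.inr rfl, ⟨(h1.trans h2).le, le_rfl⟩, ?_⟩
    rw [abs_of_neg (by linarith)]
    linarith

theorem exists_bound_in_layer (hab : ∀ i, a i < b i) (hf : ContDiffOn ℝ 1 f (Set.Icc a b))
    (h0 : ∀ x ∈ Set.Icc a b, (∃ i, x i = a i ∨ x i = b i) → f x = 0) (i : Fin n) :
    ∃ C, ∀ ε, ∀ x ∈ openBox a b, x i ∈ layer (a i) (b i) ε → |f x| ≤ C * ε := by
  obtain ⟨C, hC⟩ := isCompact_Icc.exists_bound_of_continuousOn (continuousOn_pdW hab hf i)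
  refine ⟨C * 2, fun ε x hx hl => ?_⟩
  obtain ⟨e, he, heI, hd⟩ := exists_face_near hx hl
  have hxK := openBox_subset_Icc a b hx
  have hC0 : 0 ≤ C := (norm_nonneg _).trans (hC x hxK)
  have hxi : x i ∈ Set.Icc (a i) (b i) := ⟨hxK.1 i, hxK.2 i⟩
  refine (abs_le_of_pdW_bound hf hxK heI (h0 _ (update_mem_Icc_pi hxK heI) ⟨i, by simpa⟩)
    fun s hs => hC _ (update_mem_Icc_pi hxK (Set.uIcc_subset_Icc heI hxi hs))).trans ?_
  rw [mul_assoc]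
  gcongr

theorem eventually_le_in_layer (hab : ∀ i, a i < b i) (hf : ContDiffOn ℝ 1 f (Set.Icc a b))
    (h0 : ∀ x ∈ Set.Icc a b, (∃ i, x i = a i ∨ x i = b i) → f x = 0) (i : Fin n) {c : ℝ}
    (h1 : ∀ x ∈ Set.Icc a b, (∀ j, j ≠ i → x j ∈ Set.Ioo (a j) (b j)) →
      (x i = a i ∨ x i = b i) → c * pdW (Set.Icc a b) f i x = 0) {δ : ℝ} (hδ : 0 < δ) :
    ∀ᶠ ε in 𝓝[>] (0 : ℝ), ∀ x ∈ openBox a b, x i ∈ layer (a i) (b i) ε → |c * f x| ≤ δ * ε := by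
  rcases eq_or_ne c 0 with rfl | hc
  · filter_upwards [self_mem_nhdsWithin] with ε hε x _ _
    have : 0 < ε := hε
    simp only [zero_mul, abs_zero]
    positivity
  have huc := isCompact_Icc.uniformContinuousOn_of_continuous (continuousOn_pdW hab hf i)
  have hc' : 0 < |c| := abs_pos.mpr hc
  obtain ⟨η, hη, hηδ⟩ := Metric.uniformContinuousOn_iff.mp huc (δ / (2 * |c|)) (by positivity)
  filter_upwards [Ioo_mem_nhdsGT (half_pos hη)] with ε hε x hx hl
  obtain ⟨e, he, heI, hd⟩ := exists_face_near hx hl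
  have hxK := openBox_subset_Icc a b hx
  have hxi : x i ∈ Set.Icc (a i) (b i) := ⟨hxK.1 i, hxK.2 i⟩
  have hz : pdW (Set.Icc a b) f i (Function.update x i e) = 0 := by
    refine (mul_eq_zero.mp (h1 _ (update_mem_Icc_pi hxK heI) (fun j hj => ?_)
      (by simpa))).resolve_left hc
    rw [Function.update_of_ne hj]
    exact hx j trivial
  have := abs_le_of_pdW_bound (B := δ / (2 * |c|)) hf hxK heI
    (h0 _ (update_mem_Icc_pi hxK heI) ⟨i, by simpa⟩) fun s hs => by
      have hs' := hηδ _ (update_mem_Icc_pi hxK (Set.uIcc_subset_Icc heI hxi hs)) _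
        (update_mem_Icc_pi hxK heI) ?_
      · rw [hz, dist_zero_right] at hs'
        exact hs'.le
      · have hsd : |s - e| ≤ |x i - e| := by
          rw [Set.uIcc_comm] at hs
          rw [abs_sub_comm s, abs_sub_comm (x i)]
          exact Set.abs_sub_right_of_mem_uIcc hs
        rw [dist_pi_lt_iff hη]
        intro j
        rcases eq_or_ne j i with rfl | hj
        · simp only [Function.update_self, Real.dist_eq]
          linarith [hε.2]
        · simpa [Function.update_of_ne hj] using hη
  rw [abs_mul]
  calc |c| * |f x| ≤ |c| * (δ / (2 * |c|) * (2 * ε)) := by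
        gcongr
        refine this.trans ?_
        gcongr
    _ = δ * ε := by field_simp

end BoundaryBehaviour

section GreenIdentity

open Filter Topology

variable {n : ℕ} {a b : Fin n → ℝ}

theorem eventually_mul_lt (C : ℝ) {δ : ℝ} (hδ : 0 < δ) :
    ∀ᶠ ε in 𝓝[>] (0 : ℝ), C * ε < δ := by
  have : Tendsto (fun ε : ℝ => C * ε) (𝓝 0) (𝓝 (C * 0)) :=
    (continuous_const.mul continuous_id).tendsto 0
  rw [mul_zero] at this
  exact (this.mono_left nhdsWithin_le_nhds).eventually (gt_mem_nhds hδ)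

theorem tendsto_setIntegral_mul_boxCutoff (hab : ∀ i, a i < b i) (m : Fin n → ℕ)
    {v p : (Fin n → ℝ) → ℝ} (hp : ContinuousOn p (Set.Icc a b))
    (hv : ∀ δ > 0, ∀ᶠ ε in 𝓝[>] (0 : ℝ), ∀ x ∈ openBox a b,
      (∀ j, m j ≠ 0 → x j ∈ layer (a j) (b j) ε) →
        |v x| * (ε⁻¹) ^ (∑ i, m i) ≤ δ * (ε⁻¹) ^ (Finset.univ.filter fun i => m i ≠ 0).card) :
    Tendsto (fun ε => ∫ x in openBox a b, v x * boxCutoff a b ε m x * p x) (𝓝[>] 0) (𝓝 0) := by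
  obtain ⟨C, hC0, hC⟩ := exists_bound_boxCutoff a b m
  obtain ⟨P, hP⟩ := isCompact_Icc.exists_bound_of_continuousOn hp
  refine tendsto_setIntegral_of_layer_bound hab (Finset.univ.filter fun i => m i ≠ 0)
    fun δ hδ => ?_
  have hK : 0 < (C + 1) * (|P| + 1) := by positivity
  filter_upwards [hv (δ / ((C + 1) * (|P| + 1))) (by positivity), self_mem_nhdsWithin]
    with ε h hε x hx
  have hε : 0 < ε := hε
  by_cases hl : ∀ j, m j ≠ 0 → x j ∈ layer (a j) (b j) ε
  · have hone : ∏ j ∈ Finset.univ.filter (fun i => m i ≠ 0),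
        Set.indicator (layer (a j) (b j) ε) (fun _ => (1 : ℝ)) (x j) = 1 := by
      refine Finset.prod_eq_one fun j hj => ?_
      exact Set.indicator_of_mem (hl j (Finset.mem_filter.mp hj).2) _
    have hX := hC ε x hε
    rw [hone, mul_one] at hX ⊢
    have hpx : |p x| ≤ |P| + 1 :=
      (hP x (openBox_subset_Icc a b hx)).trans ((le_abs_self P).trans (by linarith))
    rw [abs_mul, abs_mul]
    calc |v x| * |boxCutoff a b ε m x| * |p x|
        ≤ |v x| * ((C + 1) * (ε⁻¹) ^ (∑ i, m i)) * (|P| + 1) := by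
          gcongr
          refine hX.trans ?_
          gcongr
          linarith
      _ = |v x| * (ε⁻¹) ^ (∑ i, m i) * ((C + 1) * (|P| + 1)) := by ring
      _ ≤ δ / ((C + 1) * (|P| + 1)) * (ε⁻¹) ^ (Finset.univ.filter fun i => m i ≠ 0).card *
          ((C + 1) * (|P| + 1)) := by
          exact mul_le_mul_of_nonneg_right (h x hx hl) hK.le
      _ = _ := by field_simp
  · push Not at hl
    obtain ⟨j, hj, hjl⟩ := hl
    have hzero : ∏ j ∈ Finset.univ.filter (fun i => m i ≠ 0),
        Set.indicator (layer (a j) (b j) ε) (fun _ => (1 : ℝ)) (x j) = 0 :=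
      Finset.prod_eq_zero (Finset.mem_filter.mpr ⟨Finset.mem_univ j, hj⟩)
        (Set.indicator_of_notMem hjl _)
    have hX := hC ε x hε
    rw [hzero, mul_zero] at hX ⊢
    have : boxCutoff a b ε m x = 0 := abs_nonpos_iff.mp hX
    simp [this]

variable {v p : (Fin n → ℝ) → ℝ}

theorem tendsto_setIntegral_first_order (hab : ∀ i, a i < b i)
    (hv : ContDiffOn ℝ 1 v (Set.Icc a b))
    (h0 : ∀ x ∈ Set.Icc a b, (∃ i, x i = a i ∨ x i = b i) → v x = 0)
    (hp : ContinuousOn p (Set.Icc a b)) (j : Fin n) :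
    Tendsto (fun ε => ∫ x in openBox a b, v x * pd (boxCutoff a b ε 0) j x * p x)
      (𝓝[>] 0) (𝓝 0) := by
  simp only [pd_boxCutoff, zero_add]
  refine tendsto_setIntegral_mul_boxCutoff hab _ hp fun δ hδ => ?_
  have hJ : (Finset.univ.filter fun i => (Pi.single j 1 : Fin n → ℕ) i ≠ 0) = {j} := by
    ext i
    simp [Pi.single_apply]
  obtain ⟨C, hC⟩ := exists_bound_in_layer hab hv h0 j
  filter_upwards [eventually_mul_lt C hδ, self_mem_nhdsWithin] with ε hs hε x hx hl
  have hε : 0 < ε := hε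
  rw [hJ]
  simp only [Finset.sum_pi_single', Finset.mem_univ, if_true, Finset.card_singleton]
  gcongr
  exact (hC ε x hx (hl j (by simp))).trans hs.le

theorem tendsto_setIntegral_mixed (hab : ∀ i, a i < b i)
    (hv : ContDiffOn ℝ 1 v (Set.Icc a b))
    (h0 : ∀ x ∈ Set.Icc a b, (∃ i, x i = a i ∨ x i = b i) → v x = 0)
    (hp : ContinuousOn p (Set.Icc a b)) {j k : Fin n} (hjk : j ≠ k) :
    Tendsto (fun ε => ∫ x in openBox a b, v x * pd (pd (boxCutoff a b ε 0) j) k x * p x)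
      (𝓝[>] 0) (𝓝 0) := by
  simp only [pd_boxCutoff, zero_add]
  refine tendsto_setIntegral_mul_boxCutoff hab _ hp fun δ hδ => ?_
  have hJ : (Finset.univ.filter fun i =>
      (Pi.single j 1 + Pi.single k 1 : Fin n → ℕ) i ≠ 0) = {j, k} := by
    ext i
    simp only [Finset.mem_filter, Finset.mem_univ, true_and, Pi.add_apply, Pi.single_apply,
      Finset.mem_insert, Finset.mem_singleton]
    split_ifs <;> simp_all
  obtain ⟨C, hC⟩ := exists_bound_in_layer hab hv h0 j
  filter_upwards [eventually_mul_lt C hδ, self_mem_nhdsWithin] with ε hs hε x hx hl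
  have hε : 0 < ε := hε
  rw [hJ, Finset.card_pair hjk]
  simp only [Pi.add_apply, Finset.sum_add_distrib, Finset.sum_pi_single', Finset.mem_univ,
    if_true]
  norm_num
  gcongr
  exact (hC ε x hx (hl j (by simp))).trans hs.le

theorem tendsto_setIntegral_pure (hab : ∀ i, a i < b i)
    (hv : ContDiffOn ℝ 1 v (Set.Icc a b))
    (h0 : ∀ x ∈ Set.Icc a b, (∃ i, x i = a i ∨ x i = b i) → v x = 0)
    (hp : ContinuousOn p (Set.Icc a b)) {j : Fin n} {c : ℝ}
    (h1 : ∀ x ∈ Set.Icc a b, (∀ i, i ≠ j → x i ∈ Set.Ioo (a i) (b i)) →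
      (x j = a j ∨ x j = b j) → c * pdW (Set.Icc a b) v j x = 0) :
    Tendsto (fun ε => ∫ x in openBox a b, c * v x * pd (pd (boxCutoff a b ε 0) j) j x * p x)
      (𝓝[>] 0) (𝓝 0) := by
  simp only [pd_boxCutoff, zero_add]
  refine tendsto_setIntegral_mul_boxCutoff (v := fun x => c * v x) hab _ hp fun δ hδ => ?_
  have hJ : (Finset.univ.filter fun i =>
      (Pi.single j 1 + Pi.single j 1 : Fin n → ℕ) i ≠ 0) = {j} := by
    ext i
    simp [Pi.single_apply]
  filter_upwards [eventually_le_in_layer hab hv h0 j h1 hδ, self_mem_nhdsWithin]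
    with ε hs hε x hx hl
  have hε : 0 < ε := hε
  rw [hJ, Finset.card_singleton]
  simp only [Pi.add_apply, Finset.sum_add_distrib, Finset.sum_pi_single', Finset.mem_univ,
    if_true]
  have := hs x hx (hl j (by simp))
  calc |c * v x| * (ε⁻¹) ^ (1 + 1) ≤ δ * ε * (ε⁻¹) ^ (1 + 1) := by gcongr
    _ = δ * (ε⁻¹) ^ 1 := by
        rw [pow_succ (ε⁻¹) 1, pow_one]
        field_simp

theorem boxCutoff_zero_eq_zero {ε : ℝ} (hε : 0 < ε) {x : Fin n → ℝ}
    (hx : x ∉ Set.Icc (fun i => a i + ε) (fun i => b i - ε)) : boxCutoff a b ε 0 x = 0 := by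
  rw [← Set.pi_univ_Icc, Set.mem_univ_pi] at hx
  push Not at hx
  obtain ⟨i, hi⟩ := hx
  exact Finset.prod_eq_zero (Finset.mem_univ i) (by simpa using cutoff_eq_zero hε hi)

theorem abs_boxCutoff_zero_le_one (ε : ℝ) (x : Fin n → ℝ) : |boxCutoff a b ε 0 x| ≤ 1 := by
  rw [boxCutoff, Finset.abs_prod]
  refine Finset.prod_le_one (fun _ _ => abs_nonneg _) fun i _ => ?_
  simpa [abs_of_nonneg (cutoff_nonneg _ _ _ _)] using cutoff_le_one (a i) (b i) ε (x i)

theorem eventually_boxCutoff_zero_eq_one {x : Fin n → ℝ} (hx : x ∈ openBox a b) :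
    ∀ᶠ ε in 𝓝[>] (0 : ℝ), boxCutoff a b ε 0 x = 1 := by
  have h : ∀ i, ∀ᶠ ε in 𝓝[>] (0 : ℝ), x i ∉ layer (a i) (b i) ε := by
    intro i
    obtain ⟨h1, h2⟩ := hx i trivial
    have hpos : 0 < min (x i - a i) (b i - x i) / 2 := by
      have : 0 < min (x i - a i) (b i - x i) := lt_min (by linarith) (by linarith)
      linarith
    filter_upwards [Ioo_mem_nhdsGT hpos] with ε hε
    have h3 := min_le_left (x i - a i) (b i - x i)
    have h4 := min_le_right (x i - a i) (b i - x i)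
    rintro (h | h) <;> linarith [hε.2]
  filter_upwards [eventually_all.mpr h, self_mem_nhdsWithin] with ε hε hε0
  exact Finset.prod_eq_one fun i _ => by simpa using cutoff_eq_one hε0 (hε i)

theorem integrableOn_openBox_of_continuousOn (hp : ContinuousOn p (Set.Icc a b)) :
    IntegrableOn p (openBox a b) :=
  (hp.integrableOn_compact isCompact_Icc).mono_set (openBox_subset_Icc a b)

theorem tendsto_setIntegral_boxCutoff_mul {f : (Fin n → ℝ) → ℝ}
    (hf : IntegrableOn f (openBox a b)) :
    Tendsto (fun ε => ∫ x in openBox a b, boxCutoff a b ε 0 x * f x) (𝓝[>] 0)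
      (𝓝 (∫ x in openBox a b, f x)) := by
  refine tendsto_integral_filter_of_dominated_convergence (fun x => ‖f x‖) ?_ ?_ hf.norm ?_
  · refine Eventually.of_forall fun ε => ?_
    exact (contDiff_boxCutoff a b ε 0).continuous.aestronglyMeasurable.mul hf.aestronglyMeasurable
  · refine Eventually.of_forall fun ε => Eventually.of_forall fun x => ?_
    rw [norm_mul]
    exact mul_le_of_le_one_left (norm_nonneg _) (abs_boxCutoff_zero_le_one ε x)
  · filter_upwards [ae_restrict_mem (measurableSet_openBox a b)] with x hx
    refine tendsto_const_nhds.congr' ?_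
    filter_upwards [eventually_boxCutoff_zero_eq_one hx] with ε hε
    rw [hε, one_mul]

theorem tendsto_setIntegral_elasticity_term {α : ℝ} (hab : ∀ i, a i < b i)
    {V : (Fin n → ℝ) → Fin n → ℝ}
    (hV : ∀ k, ContDiffOn ℝ 1 (fun x => V x k) (Set.Icc a b))
    (h0 : ∀ k, ∀ x ∈ Set.Icc a b, (∃ i, x i = a i ∨ x i = b i) → V x k = 0)
    (h1 : ∀ i k, ∀ x ∈ Set.Icc a b, (∀ j, j ≠ i → x j ∈ Set.Ioo (a j) (b j)) →
      (x i = a i ∨ x i = b i) →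
        (1 + if k = i then α else 0) * pdW (Set.Icc a b) (fun z => V z k) i x = 0)
    {φ : (Fin n → ℝ) → Fin n → ℝ} (hφ : ∀ k, ContDiff ℝ (⊤ : ℕ∞) fun x => φ x k)
    (k j : Fin n) :
    Tendsto (fun ε => ∫ x in openBox a b, V x k *
      (pd (pd (boxCutoff a b ε 0) j) j x * φ x k
        + 2 * (pd (boxCutoff a b ε 0) j x * pd (fun y => φ y k) j x)
        + α * (pd (pd (boxCutoff a b ε 0) j) k x * φ x j
          + pd (boxCutoff a b ε 0) j x * pd (fun y => φ y j) k x
          + pd (boxCutoff a b ε 0) k x * pd (fun y => φ y j) j x))) (𝓝[>] 0) (𝓝 0) := by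
  have hφc : ∀ k, Continuous fun x => φ x k := fun k => (hφ k).continuous
  have hdφ : ∀ k i, Continuous (pd (fun x => φ x k) i) := fun k i => ((hφ k).pd i).continuous
  have hVc : ∀ k, ContinuousOn (fun x => V x k) (Set.Icc a b) := fun k => (hV k).continuousOn
  have hX : ∀ ε m, Continuous (boxCutoff a b ε m) := fun ε m =>
    (contDiff_boxCutoff a b ε m).continuous
  have hX1 : ∀ ε j, Continuous (pd (boxCutoff a b ε 0) j) := fun ε j => by
    rw [pd_boxCutoff]; exact hX _ _
  have hX2 : ∀ ε j k, Continuous (pd (pd (boxCutoff a b ε 0) j) k) := fun ε j k => by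
    rw [pd_boxCutoff, pd_boxCutoff]; exact hX _ _
  have t1 := tendsto_setIntegral_first_order hab (hV k) (h0 k)
    (p := fun x => 2 * pd (fun y => φ y k) j x + α * pd (fun y => φ y j) k x)
    (by have := hdφ k j; have := hdφ j k; fun_prop) j
  have t2 := tendsto_setIntegral_first_order hab (hV k) (h0 k)
    (p := fun x => α * pd (fun y => φ y j) j x)
    (by have := hdφ j j; fun_prop) k
  have i1 : ∀ ε, IntegrableOn (fun x => V x k * pd (boxCutoff a b ε 0) j x *
      (2 * pd (fun y => φ y k) j x + α * pd (fun y => φ y j) k x)) (openBox a b) := fun ε => by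
    refine integrableOn_openBox_of_continuousOn ?_
    have := hdφ k j; have := hdφ j k; have := hVc k; have := hX1 ε j
    fun_prop
  have i2 : ∀ ε, IntegrableOn (fun x => V x k * pd (boxCutoff a b ε 0) k x *
      (α * pd (fun y => φ y j) j x)) (openBox a b) := fun ε => by
    refine integrableOn_openBox_of_continuousOn ?_
    have := hdφ j j; have := hVc k; have := hX1 ε k
    fun_prop
  rcases eq_or_ne k j with rfl | hkj
  · have t3 := tendsto_setIntegral_pure hab (hV k) (h0 k) (p := fun x => φ x k) (c := 1 + α)
      (hφc k).continuousOn (by simpa using h1 k k)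
    have i3 : ∀ ε, IntegrableOn (fun x => (1 + α) * V x k * pd (pd (boxCutoff a b ε 0) k) k x *
        φ x k) (openBox a b) := fun ε => by
      refine integrableOn_openBox_of_continuousOn ?_
      have := hφc k; have := hVc k; have := hX2 ε k k
      fun_prop
    have := (t1.add t2).add t3
    simp only [add_zero] at this
    refine this.congr fun ε => ?_
    rw [← integral_add' (i1 ε) (i2 ε), ← integral_add' ((i1 ε).add (i2 ε)) (i3 ε)]
    refine integral_congr_ae (Eventually.of_forall fun x => ?_)
    simp only [Pi.add_apply]
    ring
  · have t3 := tendsto_setIntegral_pure hab (hV k) (h0 k) (p := fun x => φ x k) (c := 1)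
      (hφc k).continuousOn (j := j) (by simpa [hkj] using h1 j k)
    have i3 : ∀ ε, IntegrableOn (fun x => 1 * V x k * pd (pd (boxCutoff a b ε 0) j) j x *
        φ x k) (openBox a b) := fun ε => by
      refine integrableOn_openBox_of_continuousOn ?_
      have := hφc k; have := hVc k; have := hX2 ε j j
      fun_prop
    have t4 := tendsto_setIntegral_mixed hab (hV k) (h0 k) (p := fun x => α * φ x j)
      (by have := hφc j; fun_prop) hkj.symm
    have i4 : ∀ ε, IntegrableOn (fun x => V x k * pd (pd (boxCutoff a b ε 0) j) k x *
        (α * φ x j)) (openBox a b) := fun ε => by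
      refine integrableOn_openBox_of_continuousOn ?_
      have := hφc j; have := hVc k; have := hX2 ε j k
      fun_prop
    have := (t1.add t2).add (t3.add t4)
    simp only [add_zero] at this
    refine this.congr fun ε => ?_
    rw [← integral_add' (i1 ε) (i2 ε), ← integral_add' (i3 ε) (i4 ε),
      ← integral_add' ((i1 ε).add (i2 ε)) ((i3 ε).add (i4 ε))]
    refine integral_congr_ae (Eventually.of_forall fun x => ?_)
    simp only [Pi.add_apply]
    ring

/-- If `V` vanishes on the boundary together with its conormal derivative and solves
`ΔV + α grad div V = H` in the distributional sense, then `H` is orthogonal to every smooth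
solution of the homogeneous equation. -/
theorem setIntegral_eq_zero_of_homogeneous {α : ℝ} (hab : ∀ i, a i < b i)
    {V H : (Fin n → ℝ) → Fin n → ℝ}
    (hV : ∀ k, ContDiffOn ℝ 1 (fun x => V x k) (Set.Icc a b))
    (h0 : ∀ k, ∀ x ∈ Set.Icc a b, (∃ i, x i = a i ∨ x i = b i) → V x k = 0)
    (h1 : ∀ i k, ∀ x ∈ Set.Icc a b, (∀ j, j ≠ i → x j ∈ Set.Ioo (a j) (b j)) →
      (x i = a i ∨ x i = b i) →
        (1 + if k = i then α else 0) * pdW (Set.Icc a b) (fun z => V z k) i x = 0)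
    (hH : ∀ k, IntegrableOn (fun x => H x k) (Set.Icc a b))
    (hdist : ∀ ψ : (Fin n → ℝ) → Fin n → ℝ, ContDiff ℝ (⊤ : ℕ∞) ψ → HasCompactSupport ψ →
      tsupport ψ ⊆ openBox a b →
      ∫ x in openBox a b, ∑ i, V x i * (vlap ψ x i + α * gradDiv ψ x i)
        = ∫ x in openBox a b, ∑ i, H x i * ψ x i)
    {φ : (Fin n → ℝ) → Fin n → ℝ} (hφ : ∀ k, ContDiff ℝ (⊤ : ℕ∞) fun x => φ x k)
    (hom : ∀ x k, vlap φ x k + α * gradDiv φ x k = 0) :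
    ∫ x in openBox a b, ∑ i, H x i * φ x i = 0 := by
  have hφc : ∀ k, Continuous fun x => φ x k := fun k => (hφ k).continuous
  have hdφ : ∀ k i, Continuous (pd (fun x => φ x k) i) := fun k i => ((hφ k).pd i).continuous
  have hVc : ∀ k, ContinuousOn (fun x => V x k) (Set.Icc a b) := fun k => (hV k).continuousOn
  have hX : ∀ ε m, Continuous (boxCutoff a b ε m) := fun ε m =>
    (contDiff_boxCutoff a b ε m).continuous
  have hint : IntegrableOn (fun x => ∑ i, H x i * φ x i) (openBox a b) := by
    refine integrable_finsetSum _ fun i _ => ?_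
    exact ((hH i).mul_continuousOn (hφc i).continuousOn isCompact_Icc).mono_set
      (openBox_subset_Icc a b)
  have hR := tendsto_setIntegral_boxCutoff_mul hint
  have hL : Tendsto (fun ε => ∑ k, ∑ j, ∫ x in openBox a b, V x k *
      (pd (pd (boxCutoff a b ε 0) j) j x * φ x k
        + 2 * (pd (boxCutoff a b ε 0) j x * pd (fun y => φ y k) j x)
        + α * (pd (pd (boxCutoff a b ε 0) j) k x * φ x j
          + pd (boxCutoff a b ε 0) j x * pd (fun y => φ y j) k x
          + pd (boxCutoff a b ε 0) k x * pd (fun y => φ y j) j x))) (𝓝[>] 0) (𝓝 0) := by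
    have := tendsto_finsetSum (Finset.univ : Finset (Fin n)) fun k _ =>
      tendsto_finsetSum (Finset.univ : Finset (Fin n)) fun j _ =>
        tendsto_setIntegral_elasticity_term hab hV h0 h1 hφ k j
    simpa using this
  refine tendsto_nhds_unique hR (hL.congr' ?_)
  filter_upwards [self_mem_nhdsWithin] with ε hε
  have hε : 0 < ε := hε
  have hsub : tsupport (fun y i => boxCutoff a b ε 0 y * φ y i) ⊆
      Set.Icc (fun i => a i + ε) (fun i => b i - ε) := by
    refine closure_minimal (fun x hx => ?_) isClosed_Icc
    by_contra hx'
    refine hx ?_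
    funext i
    simp [boxCutoff_zero_eq_zero hε hx']
  have hd := hdist (fun y i => boxCutoff a b ε 0 y * φ y i)
    (contDiff_pi.mpr fun k => (contDiff_boxCutoff a b ε 0).mul (hφ k))
    (isCompact_Icc.of_isClosed_subset (isClosed_tsupport _) hsub)
    (hsub.trans fun x hx i _ => ⟨by linarith [hx.1 i], by linarith [hx.2 i]⟩)
  have hR' : ∀ x, boxCutoff a b ε 0 x * ∑ i, H x i * φ x i =
      ∑ i, H x i * (boxCutoff a b ε 0 x * φ x i) := fun x => by
    rw [Finset.mul_sum]
    exact Finset.sum_congr rfl fun i _ => by ring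
  simp only [hR']
  rw [← hd]
  simp only [vlap_add_gradDiv_mul α (contDiff_boxCutoff a b ε 0) hφ, hom, mul_zero, zero_add,
    Finset.mul_sum]
  have hi : ∀ k j, IntegrableOn (fun x => V x k *
      (pd (pd (boxCutoff a b ε 0) j) j x * φ x k
        + 2 * (pd (boxCutoff a b ε 0) j x * pd (fun y => φ y k) j x)
        + α * (pd (pd (boxCutoff a b ε 0) j) k x * φ x j
          + pd (boxCutoff a b ε 0) j x * pd (fun y => φ y j) k x
          + pd (boxCutoff a b ε 0) k x * pd (fun y => φ y j) j x))) (openBox a b) := by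
    intro k j
    simp only [pd_boxCutoff]
    refine integrableOn_openBox_of_continuousOn ?_
    have := hVc k; have := hφc k; have := hφc j; have := hdφ k j; have := hdφ j k
    have := hdφ j j; have := hX ε
    fun_prop
  rw [integral_finsetSum _ fun k _ => integrable_finsetSum _ fun j _ => hi k j]
  refine Finset.sum_congr rfl fun k _ => ?_
  rw [integral_finsetSum _ fun j _ => hi k j]

end GreenIdentity

section VertexExpansion

variable {n : ℕ}

/-- The exponential `exp (ξ · x)` with complex frequency `ξ`. -/
def cexpDot (ξ : Fin n → ℂ) (x : Fin n → ℝ) : ℂ := Complex.exp (∑ i, ξ i * x i)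

theorem continuous_cexpDot (ξ : Fin n → ℂ) : Continuous (cexpDot ξ) := by
  unfold cexpDot
  fun_prop

/-- The signed sum of the vertices of a box. -/
def boxVertices (lo hi : Fin n → ℝ) : (Fin n → ℝ) →₀ ℝ :=
  ∑ t ∈ (Finset.univ : Finset (Fin n)).powerset,
    Finsupp.single (fun i => if i ∈ t then hi i else lo i) ((-1) ^ t.card)

theorem prod_sub_eq_linearCombination_boxVertices {R : Type*} [CommRing R] [Algebra ℝ R]
    (g : Fin n → ℝ → R) (lo hi : Fin n → ℝ) :
    ∏ i, (g i (lo i) - g i (hi i)) =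
      Finsupp.linearCombination ℝ (fun v : Fin n → ℝ => ∏ i, g i (v i)) (boxVertices lo hi) := by
  rw [Finset.prod_sub, boxVertices, map_sum]
  refine Finset.sum_congr rfl fun t _ => ?_
  rw [Finsupp.linearCombination_single, Algebra.smul_def, mul_assoc]
  congr 1
  · simp
  · rw [← Finset.prod_sdiff (Finset.subset_univ t)]
    congr 1
    · refine Finset.prod_congr rfl fun i hit => ?_
      dsimp only
      rw [if_neg (Finset.mem_sdiff.mp hit).2]
    · refine Finset.prod_congr rfl fun i hit => ?_
      dsimp only
      rw [if_pos hit]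

/-- `μ` is a finitely supported measure of which the function `f` is the cumulative distribution
function, with the corresponding formula for exponential moments of `f` on a box. -/
structure IsVertexExpansion (a b : Fin n → ℝ) (f : (Fin n → ℝ) → ℝ) (μ : (Fin n → ℝ) →₀ ℝ) :
    Prop where
  integrableOn : IntegrableOn f (Set.Icc a b)
  apply_eq : ∀ x, f x =
    Finsupp.linearCombination ℝ (fun v : Fin n → ℝ => ∏ i, if v i ≤ x i then (1 : ℝ) else 0) μ
  moment_eq : ∀ ξ : Fin n → ℂ, (∏ i, -ξ i) * ∫ x in openBox a b, (f x : ℂ) * cexpDot ξ x =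
    Finsupp.linearCombination ℝ (cexpDot ξ) μ

namespace IsVertexExpansion

variable {a b : Fin n → ℝ} {f g : (Fin n → ℝ) → ℝ} {μ ν : (Fin n → ℝ) →₀ ℝ}

theorem integrableOn_mul_cexpDot (hf : IsVertexExpansion a b f μ) (ξ : Fin n → ℂ) :
    IntegrableOn (fun x => (f x : ℂ) * cexpDot ξ x) (openBox a b) := by
  have h : IntegrableOn (fun x => (f x : ℂ)) (Set.Icc a b) := hf.integrableOn.ofReal
  exact (h.mul_continuousOn (continuous_cexpDot ξ).continuousOn isCompact_Icc).mono_set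
    (openBox_subset_Icc a b)

theorem add (hf : IsVertexExpansion a b f μ) (hg : IsVertexExpansion a b g ν) :
    IsVertexExpansion a b (fun x => f x + g x) (μ + ν) where
  integrableOn := hf.integrableOn.add hg.integrableOn
  apply_eq x := by rw [map_add, ← hf.apply_eq, ← hg.apply_eq]
  moment_eq ξ := by
    rw [map_add, ← hf.moment_eq, ← hg.moment_eq, ← mul_add,
      ← integral_add (hf.integrableOn_mul_cexpDot ξ) (hg.integrableOn_mul_cexpDot ξ)]
    simp only [Complex.ofReal_add, add_mul]

theorem const_mul (hf : IsVertexExpansion a b f μ) (c : ℝ) :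
    IsVertexExpansion a b (fun x => c * f x) (c • μ) where
  integrableOn := hf.integrableOn.const_mul c
  apply_eq x := by rw [map_smul, ← hf.apply_eq, smul_eq_mul]
  moment_eq ξ := by
    rw [map_smul, ← hf.moment_eq]
    simp only [Complex.ofReal_mul, mul_assoc, integral_const_mul, Complex.real_smul]
    ring

theorem zero : IsVertexExpansion a b (fun _ => 0) 0 where
  integrableOn := integrableOn_zero
  apply_eq x := by simp
  moment_eq ξ := by simp

theorem sum {ι : Type*} (s : Finset ι) {f : ι → (Fin n → ℝ) → ℝ} {μ : ι → (Fin n → ℝ) →₀ ℝ}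
    (h : ∀ k, IsVertexExpansion a b (f k) (μ k)) :
    IsVertexExpansion a b (fun x => ∑ k ∈ s, f k x) (∑ k ∈ s, μ k) := by
  classical
  induction s using Finset.induction_on with
  | empty => simpa using zero
  | insert k s hk ih => simpa [Finset.sum_insert hk] using (h k).add ih

end IsVertexExpansion

theorem box_ae_eq_openBox (a b : Fin n → ℝ) : box a b =ᵐ[volume] openBox a b :=
  Measure.univ_pi_Ico_ae_eq_Icc.trans Measure.univ_pi_Ioo_ae_eq_Icc.symm

theorem measurableSet_box (a b : Fin n → ℝ) : MeasurableSet (box a b) :=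
  MeasurableSet.univ_pi fun _ => measurableSet_Ico

theorem neg_mul_setIntegral_Ico_cexp (z : ℂ) {l h : ℝ} (hlh : l ≤ h) :
    -z * ∫ s in Set.Ico l h, Complex.exp (z * s) = Complex.exp (z * l) - Complex.exp (z * h) := by
  rw [integral_Ico_eq_integral_Ioc, ← intervalIntegral.integral_of_le hlh]
  rcases eq_or_ne z 0 with rfl | hz
  · simp
  · rw [integral_exp_mul_complex hz]
    field_simp
    ring

theorem isVertexExpansion_indicator_box {a b lo hi : Fin n → ℝ} (hlh : ∀ i, lo i < hi i)
    (hsub : box lo hi ⊆ box a b) :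
    IsVertexExpansion a b (Set.indicator (box lo hi) fun _ => 1) (boxVertices lo hi) where
  integrableOn := by
    refine IntegrableOn.indicator ?_ (measurableSet_box lo hi)
    exact continuousOn_const.integrableOn_compact isCompact_Icc
  apply_eq x := by
    rw [← prod_sub_eq_linearCombination_boxVertices (fun i v => if v ≤ x i then (1 : ℝ) else 0)]
    by_cases hx : x ∈ box lo hi
    · rw [Set.indicator_of_mem hx]
      refine (Finset.prod_eq_one fun i _ => ?_).symm
      have := hx i trivial
      rw [if_pos this.1, if_neg (not_le.mpr this.2), sub_zero]
    · rw [Set.indicator_of_notMem hx]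
      simp only [box, Set.mem_univ_pi, not_forall] at hx
      obtain ⟨i, hi'⟩ := hx
      refine (Finset.prod_eq_zero (Finset.mem_univ i) ?_).symm
      rw [Set.mem_Ico, not_and_or, not_le, not_lt] at hi'
      rcases hi' with h | h
      · rw [if_neg (not_le.mpr h), if_neg (not_le.mpr (h.trans (hlh i))), sub_zero]
      · rw [if_pos ((hlh i).le.trans h), if_pos h, sub_self]
  moment_eq ξ := by
    have he : cexpDot ξ = fun v => ∏ i, Complex.exp (ξ i * v i) := by
      funext v
      rw [cexpDot, Complex.exp_sum]
    have h1 : ∀ x, ((Set.indicator (box lo hi) (fun _ => (1 : ℝ)) x : ℝ) : ℂ) * cexpDot ξ x =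
        Set.indicator (box lo hi) (cexpDot ξ) x := by
      intro x
      by_cases hx : x ∈ box lo hi <;> simp [hx]
    simp only [h1]
    rw [← setIntegral_congr_set (box_ae_eq_openBox a b),
      setIntegral_indicator (measurableSet_box lo hi), Set.inter_eq_right.mpr hsub, he,
      ← prod_sub_eq_linearCombination_boxVertices (fun i v => Complex.exp (ξ i * v)), box,
      volume_pi, Measure.restrict_pi_pi, integral_fintype_prod_eq_prod (E := fun _ => ℝ)
        (fun i s => Complex.exp (ξ i * s)), ← Finset.prod_mul_distrib]
    exact Finset.prod_congr rfl fun i _ => neg_mul_setIntegral_Ico_cexp (ξ i) (hlh i).le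

theorem Checkered.exists_isVertexExpansion {a b : Fin n → ℝ} {f : (Fin n → ℝ) → ℝ}
    (hf : Checkered (box a b) f) : ∃ μ, IsVertexExpansion a b f μ := by
  obtain ⟨N, c, lo, hi, hlh, hsub, rfl⟩ := hf
  exact ⟨_, IsVertexExpansion.sum Finset.univ fun k =>
    (isVertexExpansion_indicator_box (hlh k) (hsub k)).const_mul (c k)⟩

end VertexExpansion

section NullFrequencies

variable {n : ℕ}

theorem eq_zero_of_forall_sum_cexp_eq_zero {D : Finset (Fin n → ℝ)} {ω : Fin n → ℂ}
    (hω : Set.InjOn (fun v : Fin n → ℝ => ∑ i, ω i * v i) D) {c : (Fin n → ℝ) → ℂ}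
    (h : ∀ s : ℝ, ∑ v ∈ D, c v * cexpDot (fun i => s * ω i) v = 0) :
    ∀ v ∈ D, c v = 0 := by
  let χ : D → (Multiplicative ℝ →* ℂ) := fun v =>
    { toFun := fun s => Complex.exp ((s.toAdd : ℂ) * ∑ i, ω i * v.1 i)
      map_one' := by simp
      map_mul' := fun s t => by
        rw [← Complex.exp_add, toAdd_mul]
        push_cast
        ring_nf }
  have hderiv : ∀ z : ℂ, HasDerivAt (fun s : ℝ => Complex.exp ((s : ℂ) * z)) z 0 := by
    intro z
    have h1 : HasDerivAt (fun s : ℝ => (s : ℂ) * z) (1 * z) 0 :=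
      (Complex.ofRealCLM.hasDerivAt (x := (0 : ℝ))).mul_const z
    simpa using h1.cexp
  have hχ : Function.Injective χ := by
    intro v w hvw
    have hfun : (fun s : ℝ => Complex.exp ((s : ℂ) * ∑ i, ω i * v.1 i)) =
        fun s : ℝ => Complex.exp ((s : ℂ) * ∑ i, ω i * w.1 i) := by
      funext s
      exact DFunLike.congr_fun hvw (Multiplicative.ofAdd s)
    have h1 := hderiv (∑ i, ω i * v.1 i)
    rw [hfun] at h1
    exact Subtype.ext (hω v.2 w.2 (h1.unique (hderiv _)))
  have hli := (linearIndependent_monoidHom (Multiplicative ℝ) ℂ).comp χ hχ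
  rw [Fintype.linearIndependent_iff] at hli
  have hz := hli (fun v => c v) (by
    funext s
    have := h s.toAdd
    rw [← Finset.sum_coe_sort] at this
    simp only [Finset.sum_apply, Pi.smul_apply, Function.comp_apply, smul_eq_mul, Pi.zero_apply]
    rw [← this]
    refine Finset.sum_congr rfl fun v _ => ?_
    congr 1
    simp only [χ, MonoidHom.coe_mk, OneHom.coe_mk, cexpDot, Finset.mul_sum, mul_assoc])
  exact fun v hv => hz ⟨v, hv⟩

/-- There are null vectors separating the points of a given finite set, and not parallel to
any real vector. -/
theorem exists_null_frequency (hn : 2 ≤ n) (D : Finset (Fin n → ℝ)) :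
    ∃ ω : Fin n → ℂ, ∑ i, ω i * ω i = 0 ∧
      Set.InjOn (fun v : Fin n → ℝ => ∑ i, ω i * v i) D ∧
      ∀ c : Fin n → ℝ, (∀ j k, ω j * c k = ω k * c j) → c = 0 := by
  obtain ⟨i0, i1, h01⟩ : ∃ i0 i1 : Fin n, i0 ≠ i1 :=
    ⟨⟨0, by omega⟩, ⟨1, by omega⟩, Fin.ne_of_val_ne zero_ne_one⟩
  obtain ⟨p, hp⟩ : ∃ p : Fin n → ℝ, p i0 ≠ 0 ∧
      ∀ v ∈ D, ∀ w ∈ D, v ≠ w → ∑ i, p i * (v i - w i) ≠ 0 := by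
    let d : Option {q : D × D // q.1 ≠ q.2} → (Fin n → ℝ) := fun o =>
      o.elim (Pi.single i0 1) fun q => q.1.1.1 - q.1.2.1
    obtain ⟨f, hf⟩ := Module.exists_dual_forall_apply_ne_zero (K := ℝ) d (by
      rintro (_ | ⟨⟨v, w⟩, hvw⟩)
      · simp [d]
      · exact sub_ne_zero.mpr fun h => hvw (Subtype.ext h))
    have hfx : ∀ x : Fin n → ℝ, f x = ∑ i, f (Pi.single i 1) * x i := by
      intro x
      conv_lhs => rw [← Finset.univ_sum_single x]
      rw [map_sum]
      refine Finset.sum_congr rfl fun i _ => ?_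
      rw [mul_comm, ← smul_eq_mul, ← map_smul]
      congr 1
      ext j
      simp [Pi.single_apply]
    refine ⟨fun i => f (Pi.single i 1), hf none, fun v hv w hw hvw => ?_⟩
    have := hf (some ⟨(⟨v, hv⟩, ⟨w, hw⟩), fun h => hvw (congrArg Subtype.val h)⟩)
    rw [hfx] at this
    exact this
  obtain ⟨hp0, hpD⟩ := hp
  have hpos : 0 < p i0 ^ 2 + p i1 ^ 2 := by positivity
  have hP : 0 < ∑ i, p i ^ 2 :=
    Finset.sum_pos' (fun i _ => sq_nonneg _) ⟨i0, Finset.mem_univ _, by positivity⟩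
  set r := Real.sqrt ((∑ i, p i ^ 2) / (p i0 ^ 2 + p i1 ^ 2)) with hr
  have hr0 : 0 < r := Real.sqrt_pos.mpr (by positivity)
  have hr2 : r ^ 2 * (p i0 ^ 2 + p i1 ^ 2) = ∑ i, p i ^ 2 := by
    rw [hr, Real.sq_sqrt (by positivity)]
    field_simp
  set q : Fin n → ℝ := Pi.single i0 (-(r * p i1)) + Pi.single i1 (r * p i0) with hq
  have hq0 : q i0 = -(r * p i1) := by simp [hq, h01]
  have hq1 : q i1 = r * p i0 := by simp [hq, h01.symm]
  have hqsum : ∀ x : Fin n → ℝ, ∑ i, x i * q i = r * (p i0 * x i1 - p i1 * x i0) := by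
    intro x
    simp only [hq, Pi.add_apply, mul_add, Finset.sum_add_distrib]
    rw [Finset.sum_eq_single i0 (by intro b _ hb; simp [hb]) (by simp),
      Finset.sum_eq_single i1 (by intro b _ hb; simp [hb]) (by simp)]
    simp
    ring
  refine ⟨fun i => p i + q i * Complex.I, ?_, ?_, ?_⟩
  · have hqq : ∑ i, q i * q i = ∑ i, p i ^ 2 := by
      rw [hqsum, hq0, hq1, ← hr2]
      ring
    have hpq : ∑ i, p i * q i = 0 := by
      rw [hqsum]
      ring
    apply Complex.ext
    · have : ∀ i, (((p i : ℂ) + q i * Complex.I) * (p i + q i * Complex.I)).re =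
          p i ^ 2 - q i * q i := fun i => by simp; ring
      simp only [Complex.re_sum, this, Finset.sum_sub_distrib, hqq, sub_self, Complex.zero_re]
    · have : ∀ i, (((p i : ℂ) + q i * Complex.I) * (p i + q i * Complex.I)).im =
          2 * (p i * q i) := fun i => by simp; ring
      simp only [Complex.im_sum, this, ← Finset.mul_sum, hpq, mul_zero, Complex.zero_im]
  · intro v hv w hw hvw
    by_contra hne
    refine hpD v hv w hw hne ?_
    have := congrArg Complex.re hvw
    simp only [Complex.re_sum] at this
    simp only [mul_sub, Finset.sum_sub_distrib, sub_eq_zero]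
    simpa using this
  · intro c hc
    have h10 := hc i0 i1
    have hre : p i0 * c i1 = p i1 * c i0 := by simpa using congrArg Complex.re h10
    have him : q i0 * c i1 = q i1 * c i0 := by simpa using congrArg Complex.im h10
    rw [hq0, hq1] at him
    have hc0 : c i0 = 0 := by
      have h2 : r * ((p i0 ^ 2 + p i1 ^ 2) * c i0) = 0 := by
        linear_combination -p i0 * him - r * p i1 * hre
      have h3 := (mul_eq_zero.mp h2).resolve_left hr0.ne'
      exact (mul_eq_zero.mp h3).resolve_left hpos.ne'
    funext k
    have hk : p i0 * c k = p k * c i0 := by simpa using congrArg Complex.re (hc i0 k)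
    rw [hc0, mul_zero] at hk
    exact (mul_eq_zero.mp hk).resolve_left hp0

end NullFrequencies

section ExponentialFields

variable {n : ℕ}

/-- The real part of a multiple of a complex exponential. -/
def expRe (ξ : Fin n → ℂ) (A : ℂ) (x : Fin n → ℝ) : ℝ := (A * cexpDot ξ x).re

/-- The `i`-th coordinate as a complex-valued real-linear functional. -/
def complexCoord (i : Fin n) : (Fin n → ℝ) →L[ℝ] ℂ :=
  Complex.ofRealCLM.comp (ContinuousLinearMap.proj i)

theorem complexCoord_apply (i : Fin n) (x : Fin n → ℝ) : complexCoord i x = x i := rfl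

theorem hasFDerivAt_cexpDot (ξ : Fin n → ℂ) (x : Fin n → ℝ) :
    HasFDerivAt (cexpDot ξ) (cexpDot ξ x • ∑ i, ξ i • complexCoord i) x := by
  have h : HasFDerivAt (fun x : Fin n → ℝ => ∑ i, ξ i * complexCoord i x)
      (∑ i, ξ i • complexCoord i) x :=
    HasFDerivAt.fun_sum fun i _ => (complexCoord i).hasFDerivAt.const_mul (ξ i)
  exact h.cexp

theorem contDiff_expRe (ξ : Fin n → ℂ) (A : ℂ) : ContDiff ℝ (⊤ : ℕ∞) (expRe ξ A) := by
  have h : ContDiff ℝ (⊤ : ℕ∞) (fun x : Fin n → ℝ => ∑ i, ξ i * complexCoord i x) :=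
    ContDiff.sum fun i _ => contDiff_const.mul (complexCoord i).contDiff
  exact Complex.reCLM.contDiff.comp (contDiff_const.mul h.cexp)

theorem pd_expRe (ξ : Fin n → ℂ) (A : ℂ) (j : Fin n) :
    pd (expRe ξ A) j = expRe ξ (A * ξ j) := by
  funext x
  have h : HasFDerivAt (expRe ξ A) _ x :=
    Complex.reCLM.hasFDerivAt.comp x ((hasFDerivAt_cexpDot ξ x).const_mul A)
  rw [pd, h.fderiv]
  simp only [ContinuousLinearMap.comp_apply, smul_apply, sum_apply, smul_eq_mul,
    complexCoord_apply, Complex.reCLM_apply, expRe]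
  rw [Finset.sum_eq_single j (by intro i _ hi; simp [hi]) (by simp)]
  simp only [Pi.single_eq_same, Complex.ofReal_one, mul_one]
  ring_nf

theorem sum_expRe (ξ : Fin n → ℂ) (A : Fin n → ℂ) (x : Fin n → ℝ) :
    ∑ k, expRe ξ (A k) x = expRe ξ (∑ k, A k) x := by
  simp only [expRe, Finset.sum_mul, Complex.re_sum]

theorem expRe_zero (ξ : Fin n → ℂ) : expRe ξ 0 = fun _ => 0 := by
  funext x
  simp [expRe]

theorem vlap_add_gradDiv_expRe (α : ℝ) {ξ η : Fin n → ℂ} (hξ : ∑ i, ξ i * ξ i = 0)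
    (hη : ∑ i, η i * ξ i = 0) (x : Fin n → ℝ) (k : Fin n) :
    vlap (fun x k => expRe ξ (η k) x) x k +
      α * gradDiv (fun x k => expRe ξ (η k) x) x k = 0 := by
  have h1 : vlap (fun x k => expRe ξ (η k) x) x k = 0 := by
    have : vlap (fun x k => expRe ξ (η k) x) x k = ∑ j, pd (pd (expRe ξ (η k)) j) j x := rfl
    simp only [this, pd_expRe, sum_expRe, mul_assoc, ← Finset.mul_sum, hξ, mul_zero, expRe_zero]
  have h2 : divg (fun x k => expRe ξ (η k) x) = fun _ => 0 := by
    funext y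
    have : divg (fun x k => expRe ξ (η k) x) y = ∑ j, pd (expRe ξ (η j)) j y := rfl
    simp only [this, pd_expRe, sum_expRe, hη, expRe_zero]
  rw [h1, gradDiv, h2]
  simp [pd]

theorem sum_mul_setIntegral_cexpDot_eq_zero (α : ℝ) {a b : Fin n → ℝ}
    {H : (Fin n → ℝ) → Fin n → ℝ}
    (horth : ∀ φ : (Fin n → ℝ) → Fin n → ℝ, (∀ k, ContDiff ℝ (⊤ : ℕ∞) fun x => φ x k) →
      (∀ x k, vlap φ x k + α * gradDiv φ x k = 0) → ∫ x in openBox a b, ∑ i, H x i * φ x i = 0)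
    {ξ η : Fin n → ℂ}
    (hint : ∀ k, IntegrableOn (fun x => (H x k : ℂ) * cexpDot ξ x) (openBox a b))
    (hξ : ∑ i, ξ i * ξ i = 0) (hη : ∑ i, η i * ξ i = 0) :
    ∑ k, η k * ∫ x in openBox a b, (H x k : ℂ) * cexpDot ξ x = 0 := by
  have hre : ∀ c : ℂ,
      (c * ∑ k, η k * ∫ x in openBox a b, (H x k : ℂ) * cexpDot ξ x).re = 0 := by
    intro c
    have hint' : ∀ k, Integrable (fun x => c * η k * ((H x k : ℂ) * cexpDot ξ x))
        (volume.restrict (openBox a b)) := fun k => (hint k).const_mul _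
    have h0 := horth (fun x k => expRe ξ (c * η k) x) (fun k => contDiff_expRe ξ _)
      (vlap_add_gradDiv_expRe α hξ (by simp only [mul_assoc, ← Finset.mul_sum, hη, mul_zero]))
    have h1 : ∀ x, ∑ i, H x i * expRe ξ (c * η i) x =
        Complex.reCLM (∑ i, c * η i * ((H x i : ℂ) * cexpDot ξ x)) := by
      intro x
      rw [map_sum]
      refine Finset.sum_congr rfl fun i _ => ?_
      rw [mul_left_comm, Complex.reCLM_apply, Complex.re_ofReal_mul, expRe]
    simp only [h1] at h0
    rw [ContinuousLinearMap.integral_comp_comm _ (integrable_finsetSum _ fun k _ => hint' k),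
      integral_finsetSum _ fun k _ => hint' k] at h0
    simp only [integral_const_mul, Complex.reCLM_apply] at h0
    simpa only [Finset.mul_sum, mul_assoc] using h0
  apply Complex.ext
  · simpa using hre 1
  · simpa using hre (-Complex.I)

/-- A vector field with vertex expansions orthogonal to all homogeneous solutions vanishes. -/
theorem eq_zero_of_isVertexExpansion (hn : 2 ≤ n) (α : ℝ) {a b : Fin n → ℝ}
    {H : (Fin n → ℝ) → Fin n → ℝ}
    (horth : ∀ φ : (Fin n → ℝ) → Fin n → ℝ, (∀ k, ContDiff ℝ (⊤ : ℕ∞) fun x => φ x k) →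
      (∀ x k, vlap φ x k + α * gradDiv φ x k = 0) → ∫ x in openBox a b, ∑ i, H x i * φ x i = 0)
    {μ : Fin n → (Fin n → ℝ) →₀ ℝ} (hμ : ∀ k, IsVertexExpansion a b (fun x => H x k) (μ k)) :
    H = 0 := by
  classical
  set D : Finset (Fin n → ℝ) := Finset.univ.biUnion fun k => (μ k).support with hD
  have hDsub : ∀ k, (μ k).support ⊆ D := fun k =>
    Finset.subset_biUnion_of_mem (fun k => (μ k).support) (Finset.mem_univ k)
  obtain ⟨ω, hω, hinj, hpar⟩ := exists_null_frequency hn D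
  have hcombo : ∀ (ξ : Fin n → ℂ) k, Finsupp.linearCombination ℝ (cexpDot ξ) (μ k) =
      ∑ v ∈ D, (μ k v : ℂ) * cexpDot ξ v := by
    intro ξ k
    rw [Finsupp.linearCombination_apply, Finsupp.sum_of_support_subset _ (hDsub k) _ (by simp)]
    simp only [Complex.real_smul]
  have hcross : ∀ j k, ∀ v ∈ D, ω j * μ k v - ω k * μ j v = 0 := by
    intro j k
    refine eq_zero_of_forall_sum_cexp_eq_zero hinj fun s => ?_
    set ξ : Fin n → ℂ := fun i => s * ω i with hξ
    have hξξ : ∑ i, ξ i * ξ i = 0 := by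
      have : ∀ i, ξ i * ξ i = s ^ 2 * (ω i * ω i) := fun i => by simp only [hξ]; ring
      simp only [this, ← Finset.mul_sum, hω, mul_zero]
    have hsum : ∀ f : Fin n → ℂ, ∑ i, (Pi.single k (ω j) - Pi.single j (ω k) : Fin n → ℂ) i * f i
        = ω j * f k - ω k * f j := by
      intro f
      simp only [Pi.sub_apply, sub_mul, Finset.sum_sub_distrib]
      rw [Finset.sum_eq_single k (by intro i _ hi; simp [hi]) (by simp),
        Finset.sum_eq_single j (by intro i _ hi; simp [hi]) (by simp)]
      simp
    have h0 := sum_mul_setIntegral_cexpDot_eq_zero α horth (ξ := ξ)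
      (η := Pi.single k (ω j) - Pi.single j (ω k))
      (fun k => (hμ k).integrableOn_mul_cexpDot ξ) hξξ (by
        rw [hsum]
        simp only [hξ]
        ring)
    rw [hsum] at h0
    have h1 := (hμ k).moment_eq ξ
    have h2 := (hμ j).moment_eq ξ
    rw [hcombo] at h1 h2
    have h3 : ∑ v ∈ D, (ω j * μ k v - ω k * μ j v) * cexpDot ξ v =
        ω j * ∑ v ∈ D, (μ k v : ℂ) * cexpDot ξ v - ω k * ∑ v ∈ D, (μ j v : ℂ) * cexpDot ξ v := by
      simp only [Finset.mul_sum, ← Finset.sum_sub_distrib]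
      exact Finset.sum_congr rfl fun v _ => by ring
    rw [h3, ← h1, ← h2]
    linear_combination (∏ i, -ξ i) * h0
  have hμ0 : ∀ k, μ k = 0 := by
    intro k
    ext v
    by_cases hv : v ∈ D
    · exact congrFun (hpar (fun k => μ k v) fun i j => sub_eq_zero.mp (hcross i j v hv)) k
    · exact Finsupp.notMem_support_iff.mp fun h => hv (hDsub k h)
  funext x k
  have := (hμ k).apply_eq x
  rw [hμ0 k, map_zero] at this
  exact this

end ExponentialFields

section Assembly

variable {n : ℕ} {a b : Fin n → ℝ}

theorem closure_box (hab : ∀ i, a i < b i) : closure (box a b) = Set.Icc a b := by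
  rw [box, closure_pi_set, ← Set.pi_univ_Icc]
  simp only [closure_Ico (hab _).ne]

theorem interior_box (a b : Fin n → ℝ) : interior (box a b) = openBox a b := by
  rw [box, interior_pi_set Set.finite_univ, openBox]
  simp only [interior_Ico]

theorem mem_frontier_box (hab : ∀ i, a i < b i) {x : Fin n → ℝ} (hx : x ∈ Set.Icc a b)
    (hi : ∃ i, x i = a i ∨ x i = b i) : x ∈ frontier (box a b) := by
  rw [frontier, closure_box hab, interior_box]
  refine ⟨hx, fun h => ?_⟩
  obtain ⟨i, hi | hi⟩ := hi
  · exact (h i trivial).1.ne' hi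
  · exact (h i trivial).2.ne hi

theorem pdW_sub (hab : ∀ i, a i < b i) {f g : (Fin n → ℝ) → ℝ}
    (hf : ContDiffOn ℝ 1 f (Set.Icc a b)) (hg : ContDiffOn ℝ 1 g (Set.Icc a b)) (i : Fin n)
    {x : Fin n → ℝ} (hx : x ∈ Set.Icc a b) :
    pdW (Set.Icc a b) (fun z => f z - g z) i x =
      pdW (Set.Icc a b) f i x - pdW (Set.Icc a b) g i x := by
  rw [pdW, fderivWithin_fun_sub (uniqueDiffOn_Icc_pi hab x hx)
    (hf.differentiableOn one_ne_zero x hx) (hg.differentiableOn one_ne_zero x hx)]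
  rfl

theorem stress_sub (hab : ∀ i, a i < b i) (α : ℝ) {U W : (Fin n → ℝ) → Fin n → ℝ}
    (hU : ∀ k, ContDiffOn ℝ 1 (fun x => U x k) (Set.Icc a b))
    (hW : ∀ k, ContDiffOn ℝ 1 (fun x => W x k) (Set.Icc a b))
    {x : Fin n → ℝ} (hx : x ∈ Set.Icc a b) (i j : Fin n) :
    stress α (Set.Icc a b) (fun z k => U z k - W z k) x i j =
      stress α (Set.Icc a b) U x i j - stress α (Set.Icc a b) W x i j := by
  simp only [stress, pdW_sub hab (hU _) (hW _) _ hx, Finset.sum_sub_distrib]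
  ring

/-- On a face where a vector field vanishes, the traction only involves normal derivatives. -/
theorem stress_eq_of_eq_zero_on_boundary (hab : ∀ i, a i < b i) (α : ℝ)
    {V : (Fin n → ℝ) → Fin n → ℝ} (hV : ∀ k, ContDiffOn ℝ 1 (fun x => V x k) (Set.Icc a b))
    (h0 : ∀ k, ∀ x ∈ Set.Icc a b, (∃ i, x i = a i ∨ x i = b i) → V x k = 0)
    {x : Fin n → ℝ} (hx : x ∈ Set.Icc a b) {i : Fin n} (hi : x i = a i ∨ x i = b i) (k : Fin n) :
    stress α (Set.Icc a b) V x k i =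
      (1 + if k = i then α else 0) * pdW (Set.Icc a b) (fun z => V z k) i x := by
  have ht : ∀ l j, j ≠ i → pdW (Set.Icc a b) (fun z => V z l) j x = 0 := fun l j hj =>
    pdW_eq_zero_of_tangential hab (hV l) (h0 l) hx hi hj
  rw [stress]
  rcases eq_or_ne k i with rfl | hk
  · rw [Finset.sum_eq_single k (fun j _ hj => ht j j hj) (by simp), if_pos rfl, if_pos rfl]
    ring
  · rw [if_neg hk, if_neg hk, ht i k hk]
    ring

theorem continuous_vlap_add_gradDiv (α : ℝ) {ψ : (Fin n → ℝ) → Fin n → ℝ}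
    (hψ : ContDiff ℝ (⊤ : ℕ∞) ψ) (k : Fin n) :
    Continuous fun x => vlap ψ x k + α * gradDiv ψ x k := by
  have hc : ∀ i, ContDiff ℝ (⊤ : ℕ∞) fun x => ψ x i := contDiff_pi.mp hψ
  have hd : ContDiff ℝ (⊤ : ℕ∞) (divg ψ) := ContDiff.sum fun i _ => (hc i).pd i
  have hv : Continuous fun x => vlap ψ x k :=
    continuous_finsetSum _ fun j _ => (((hc k).pd j).pd j).continuous
  exact hv.add ((hd.pd k).continuous.const_mul α)

theorem setIntegral_openBox_sum_sub_mul {P Q L : (Fin n → ℝ) → Fin n → ℝ}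
    (hP : ∀ k, IntegrableOn (fun x => P x k) (Set.Icc a b))
    (hQ : ∀ k, IntegrableOn (fun x => Q x k) (Set.Icc a b))
    (hL : ∀ k, Continuous fun x => L x k) :
    ∫ x in openBox a b, ∑ i, (P x i - Q x i) * L x i =
      (∫ x in box a b, ∑ i, P x i * L x i) - ∫ x in box a b, ∑ i, Q x i * L x i := by
  have hint : ∀ {R : (Fin n → ℝ) → Fin n → ℝ}, (∀ k, IntegrableOn (fun x => R x k) (Set.Icc a b)) →
      Integrable (fun x => ∑ i, R x i * L x i) (volume.restrict (openBox a b)) := fun hR =>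
    integrable_finsetSum _ fun i _ => ((hR i).mul_continuousOn (hL i).continuousOn
      isCompact_Icc).mono_set (openBox_subset_Icc a b)
  rw [setIntegral_congr_set (box_ae_eq_openBox a b), setIntegral_congr_set (box_ae_eq_openBox a b),
    ← integral_sub (hint hP) (hint hQ)]
  simp only [sub_mul, Finset.sum_sub_distrib]

end Assembly

/-- Uniqueness for the inverse elasticity problem with checkered internal stress
distributions on a box. -/
theorem inverse_elasticity_uniqueness_checkered
    {n : ℕ} (hn : 2 ≤ n) (α : ℝ) (a b : Fin n → ℝ) (hab : ∀ i, a i < b i)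
    (F G U W : (Fin n → ℝ) → Fin n → ℝ)
    (hF : ∀ i, Checkered (box a b) fun x => F x i)
    (hG : ∀ i, Checkered (box a b) fun x => G x i)
    (hU : ContDiffOn ℝ 1 U (closure (box a b)))
    (hW : ContDiffOn ℝ 1 W (closure (box a b)))
    -- `ΔU + α·grad div U = F` in the distributional sense on the interior of the box
    (hUdist : ∀ φ : (Fin n → ℝ) → Fin n → ℝ, ContDiff ℝ (⊤ : ℕ∞) φ → HasCompactSupport φ →
      tsupport φ ⊆ interior (box a b) →
      ∫ x in box a b, ∑ i, U x i * (vlap φ x i + α * gradDiv φ x i)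
        = ∫ x in box a b, ∑ i, F x i * φ x i)
    -- `ΔW + α·grad div W = G` in the distributional sense on the interior of the box
    (hWdist : ∀ φ : (Fin n → ℝ) → Fin n → ℝ, ContDiff ℝ (⊤ : ℕ∞) φ → HasCompactSupport φ →
      tsupport φ ⊆ interior (box a b) →
      ∫ x in box a b, ∑ i, W x i * (vlap φ x i + α * gradDiv φ x i)
        = ∫ x in box a b, ∑ i, G x i * φ x i)
    -- Dirichlet data coincide on the boundary
    (hDir : ∀ x ∈ frontier (box a b), U x = W x)
    -- traction data coincide on the relative interior of each (n−1)-dimensional face,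
    -- `ν` being the corresponding outward unit normal
    (hNeu : ∀ (i : Fin n) (x : Fin n → ℝ), x ∈ closure (box a b) →
      (∀ j, j ≠ i → x j ∈ Set.Ioo (a j) (b j)) →
      ∀ ν : Fin n → ℝ,
        ((x i = a i ∧ ν = -Pi.single i 1) ∨ (x i = b i ∧ ν = Pi.single i 1)) →
        ∀ k : Fin n,
          ∑ j, stress α (closure (box a b)) U x k j * ν j
            = ∑ j, stress α (closure (box a b)) W x k j * ν j) :
    F =ᵐ[volume.restrict (box a b)] G := by
  choose μ hμ using fun i => (hF i).exists_isVertexExpansion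
  choose ρ hρ using fun i => (hG i).exists_isVertexExpansion
  rw [closure_box hab] at hU hW hNeu
  rw [interior_box] at hUdist hWdist
  have hUk : ∀ k, ContDiffOn ℝ 1 (fun x => U x k) (Set.Icc a b) := contDiffOn_pi.mp hU
  have hWk : ∀ k, ContDiffOn ℝ 1 (fun x => W x k) (Set.Icc a b) := contDiffOn_pi.mp hW
  have hVk : ∀ k, ContDiffOn ℝ 1 (fun x => U x k - W x k) (Set.Icc a b) := fun k =>
    (hUk k).sub (hWk k)
  have h0 : ∀ k, ∀ x ∈ Set.Icc a b, (∃ i, x i = a i ∨ x i = b i) → U x k - W x k = 0 :=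
    fun k x hx hi => by rw [hDir x (mem_frontier_box hab hx hi), sub_self]
  have h1 : ∀ i k, ∀ x ∈ Set.Icc a b, (∀ j, j ≠ i → x j ∈ Set.Ioo (a j) (b j)) →
      (x i = a i ∨ x i = b i) →
        (1 + if k = i then α else 0) * pdW (Set.Icc a b) (fun z => U z k - W z k) i x = 0 := by
    intro i k x hx hj hi
    rw [← stress_eq_of_eq_zero_on_boundary hab α hVk h0 hx hi k, stress_sub hab α hUk hWk hx]
    have hcol : ∀ g : Fin n → ℝ, ∑ j, g j * (Pi.single i 1 : Fin n → ℝ) j = g i := fun g => by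
      simp [Pi.single_apply]
    rcases hi with hi | hi
    · have := hNeu i x hx hj _ (Or.inl ⟨hi, rfl⟩) k
      simp only [Pi.neg_apply, mul_neg, Finset.sum_neg_distrib, hcol, neg_inj] at this
      rw [this, sub_self]
    · have := hNeu i x hx hj _ (Or.inr ⟨hi, rfl⟩) k
      rw [hcol, hcol] at this
      rw [this, sub_self]
  have hint : ∀ {R : (Fin n → ℝ) → Fin n → ℝ} (k : Fin n),
      ContDiffOn ℝ 1 (fun x => R x k) (Set.Icc a b) → IntegrableOn (fun x => R x k) (Set.Icc a b) :=
    fun k hR => hR.continuousOn.integrableOn_compact isCompact_Icc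
  have hdist : ∀ ψ : (Fin n → ℝ) → Fin n → ℝ, ContDiff ℝ (⊤ : ℕ∞) ψ → HasCompactSupport ψ →
      tsupport ψ ⊆ openBox a b →
      ∫ x in openBox a b, ∑ i, (U x i - W x i) * (vlap ψ x i + α * gradDiv ψ x i)
        = ∫ x in openBox a b, ∑ i, (F x i - G x i) * ψ x i := by
    intro ψ hψ hc hs
    rw [setIntegral_openBox_sum_sub_mul (L := fun x i => vlap ψ x i + α * gradDiv ψ x i)
        (fun k => hint k (hUk k)) (fun k => hint k (hWk k)) (continuous_vlap_add_gradDiv α hψ),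
      setIntegral_openBox_sum_sub_mul (L := ψ) (fun k => (hμ k).integrableOn)
        (fun k => (hρ k).integrableOn) (fun k => (continuous_apply k).comp hψ.continuous),
      hUdist ψ hψ hc hs, hWdist ψ hψ hc hs]
  have hzero : (fun x i => F x i - G x i) = 0 := by
    refine eq_zero_of_isVertexExpansion hn α (a := a) (b := b) (fun φ hφ hom => ?_)
      (μ := fun k => μ k + (-1 : ℝ) • ρ k) fun k => ?_
    · exact setIntegral_eq_zero_of_homogeneous hab hVk h0 h1
        (fun k => (hμ k).integrableOn.sub (hρ k).integrableOn) hdist hφ hom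
    · simpa [sub_eq_add_neg] using (hμ k).add ((hρ k).const_mul (-1))
  refine Filter.Eventually.of_forall fun x => funext fun i => ?_
  exact sub_eq_zero.mp (congrFun (congrFun hzero x) i)
end
end

section
/- Let g₁, g₂, g₃ : ℝ³ → ℝ be functions supported on finite sets. Suppose that for every real α ≠ 0 and every admissible pair (Θ,Ψ), writing c_l = Θ_l + iΨ_l, one has Σ_v exp(α⟨Θ,v⟩ + iα⟨Ψ,v⟩)·(g₂(v)·c₃ − g₃(v)·c₂) = 0 and Σ_v exp(α⟨Θ,v⟩ + iα⟨Ψ,v⟩)·(g₃(v)·c₁ − g₁(v)·c₃) = 0, where the sums run over the union of the supports of g₁, g₂, g₃. Then g₁ = g₂ = g₃ = 0. -/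
noncomputable section

/-- A pair `(Θ,Ψ)` of orthogonal unit vectors in `ℝ³` is admissible if
`Θ_l + iΨ_l ≠ 0` for each `l`. -/
def Admissible (Θ Ψ : Fin 3 → ℝ) : Prop :=
  (∑ l, Θ l ^ 2 = 1) ∧ (∑ l, Ψ l ^ 2 = 1) ∧ (∑ l, Θ l * Ψ l = 0) ∧
    ∀ l, (Θ l : ℂ) + Ψ l * Complex.I ≠ 0

/-- The character `α ↦ exp (α z)` of the additive group of the reals. -/
def expCharacter (z : ℂ) : Multiplicative ℝ →* ℂ where
  toFun α := Complex.exp ((α.toAdd : ℂ) * z)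
  map_one' := by simp
  map_mul' a b := by
    rw [← Complex.exp_add, toAdd_mul]
    push_cast
    ring_nf

theorem expCharacter_injective : Function.Injective expCharacter := by
  intro z w h
  have hd (u : ℂ) : HasDerivAt (fun α : ℝ => Complex.exp ((α : ℂ) * u)) u 0 := by
    simpa using (((hasDerivAt_id (0 : ℝ)).ofReal_comp).mul_const u).cexp
  have hfun : (fun α : ℝ => Complex.exp ((α : ℂ) * z)) = fun α : ℝ => Complex.exp ((α : ℂ) * w) := by
    funext α
    exact DFunLike.congr_fun h (Multiplicative.ofAdd α)
  exact (hd z).unique (hfun ▸ hd w)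

/-- A finite exponential sum with distinct exponents that vanishes for all nonzero real
parameters has zero coefficients. -/
theorem eq_zero_of_sum_exp_eq_zero {ι : Type*} (s : Finset ι) (z k : ι → ℂ)
    (hz : Set.InjOn z s)
    (h : ∀ α : ℝ, α ≠ 0 → ∑ v ∈ s, Complex.exp ((α : ℂ) * z v) * k v = 0) :
    ∀ v ∈ s, k v = 0 := by
  have hall : (fun α : ℝ => ∑ v ∈ s, Complex.exp ((α : ℂ) * z v) * k v) = fun _ => 0 := by
    refine Continuous.ext_on (dense_compl_singleton (0 : ℝ)) (by fun_prop) continuous_const ?_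
    intro α hα
    exact h α hα
  have hinj : Function.Injective fun v : s => expCharacter (z v) := fun v w hvw =>
    Subtype.ext (hz v.2 w.2 (expCharacter_injective hvw))
  have hli := (linearIndependent_monoidHom (Multiplicative ℝ) ℂ).comp _ hinj
  rw [Fintype.linearIndependent_iff] at hli
  intro v hv
  refine hli (fun v => k v) ?_ ⟨v, hv⟩
  funext α
  have := congrFun hall α.toAdd
  rw [← Finset.sum_coe_sort] at this
  simpa [Finset.sum_apply, expCharacter, mul_comm] using this

/-- There is an admissible pair whose common orthogonal line avoids finitely many given
nonzero directions. -/
theorem exists_admissible_forall_ne_zero (D : Set (Fin 3 → ℝ)) (hD : D.Finite) (h0 : 0 ∉ D) :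
    ∃ Θ Ψ : Fin 3 → ℝ, Admissible Θ Ψ ∧
      ∀ d ∈ D, ¬ (∑ l, Θ l * d l = 0 ∧ ∑ l, Ψ l * d l = 0) := by
  obtain ⟨t, ht⟩ := ((hD.image fun d => d 1 / d 0).insert 0).exists_notMem
  rw [Set.mem_insert_iff, not_or] at ht
  obtain ⟨ht0, htD⟩ := ht
  set p : ℝ := √(1 + t ^ 2) with hp
  set q : ℝ := √(t ^ 4 + t ^ 6 + (1 + t ^ 2) ^ 2) with hq
  have hp2 : p ^ 2 = 1 + t ^ 2 := Real.sq_sqrt (by positivity)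
  have hq2 : q ^ 2 = t ^ 4 + t ^ 6 + (1 + t ^ 2) ^ 2 := Real.sq_sqrt (by positivity)
  have hp0 : p ≠ 0 := by positivity
  have hq0 : q ≠ 0 := by positivity
  have ht1 : 1 + t ^ 2 ≠ 0 := by positivity
  refine ⟨![t / p, -1 / p, 0], ![t ^ 2 / q, t ^ 3 / q, -(1 + t ^ 2) / q], ⟨?_, ?_, ?_, ?_⟩, ?_⟩
  · simp only [Fin.sum_univ_three, Matrix.cons_val]
    field_simp
    linarith
  · simp only [Fin.sum_univ_three, Matrix.cons_val]
    field_simp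
    linarith
  · simp only [Fin.sum_univ_three, Matrix.cons_val]
    field_simp
    ring
  · intro l hl
    have hre := congrArg Complex.re hl
    have him := congrArg Complex.im hl
    rw [Complex.add_re, Complex.ofReal_re, Complex.re_ofReal_mul, Complex.I_re, mul_zero,
      add_zero, Complex.zero_re] at hre
    rw [Complex.add_im, Complex.ofReal_im, Complex.im_ofReal_mul, Complex.I_im, zero_add,
      mul_one, Complex.zero_im] at him
    fin_cases l
    · exact div_ne_zero ht0 hp0 hre
    · exact div_ne_zero (by norm_num) hp0 hre
    · exact div_ne_zero (neg_ne_zero.2 ht1) hq0 him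
  · rintro d hd ⟨hΘ, hΨ⟩
    simp only [Fin.sum_univ_three, Matrix.cons_val] at hΘ hΨ
    field_simp at hΘ hΨ
    have h1 : d 1 = t * d 0 := by linarith
    have h2 : d 2 = t ^ 2 * d 0 := by
      rw [h1] at hΨ
      apply mul_left_cancel₀ ht1
      linarith
    by_cases hd0 : d 0 = 0
    · refine h0 ?_
      convert hd
      funext l
      fin_cases l <;> simp [h1, h2, hd0]
    · exact htD ⟨d, hd, by simp [h1, hd0]⟩

/-- A real vector parallel to `Θ + iΨ` for an admissible pair vanishes. -/
theorem Admissible.eq_zero_of_parallel {Θ Ψ : Fin 3 → ℝ} (h : Admissible Θ Ψ) {a b c : ℝ}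
    (hbc : (b : ℂ) * ((Θ 2 : ℂ) + Ψ 2 * Complex.I)
      - (c : ℂ) * ((Θ 1 : ℂ) + Ψ 1 * Complex.I) = 0)
    (hca : (c : ℂ) * ((Θ 0 : ℂ) + Ψ 0 * Complex.I)
      - (a : ℂ) * ((Θ 2 : ℂ) + Ψ 2 * Complex.I) = 0) :
    a = 0 ∧ b = 0 ∧ c = 0 := by
  obtain ⟨hΘ, hΨ, hΘΨ, hne⟩ := h
  simp only [Fin.sum_univ_three] at hΘ hΨ hΘΨ
  set x := (Θ 0 : ℂ) + Ψ 0 * Complex.I with hx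
  set y := (Θ 1 : ℂ) + Ψ 1 * Complex.I with hy
  set z := (Θ 2 : ℂ) + Ψ 2 * Complex.I with hz
  have hz0 : z ≠ 0 := hne 2
  have hiso : x ^ 2 + y ^ 2 + z ^ 2 = 0 := by
    have e1 : (Θ 0 : ℂ) ^ 2 + (Θ 1 : ℂ) ^ 2 + (Θ 2 : ℂ) ^ 2 = 1 := by exact_mod_cast hΘ
    have e2 : (Ψ 0 : ℂ) ^ 2 + (Ψ 1 : ℂ) ^ 2 + (Ψ 2 : ℂ) ^ 2 = 1 := by exact_mod_cast hΨ
    have e3 : (Θ 0 : ℂ) * Ψ 0 + (Θ 1 : ℂ) * Ψ 1 + (Θ 2 : ℂ) * Ψ 2 = 0 := by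
      exact_mod_cast hΘΨ
    rw [hx, hy, hz]
    linear_combination e1 - e2 + 2 * Complex.I * e3 +
      ((Ψ 0 : ℂ) ^ 2 + (Ψ 1 : ℂ) ^ 2 + (Ψ 2 : ℂ) ^ 2) * Complex.I_sq
  have hsq : ((a : ℂ) ^ 2 + (b : ℂ) ^ 2 + (c : ℂ) ^ 2) * z ^ 2 = 0 := by
    linear_combination (c : ℂ) ^ 2 * hiso + (b * z + c * y) * hbc - (c * x + a * z) * hca
  have hnorm : a ^ 2 + b ^ 2 + c ^ 2 = 0 := by
    exact_mod_cast (mul_eq_zero.1 hsq).resolve_right (pow_ne_zero 2 hz0)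
  refine ⟨?_, ?_, ?_⟩ <;> nlinarith [sq_nonneg a, sq_nonneg b, sq_nonneg c]

/-- If the finitely supported functions `g₁, g₂, g₃ : ℝ³ → ℝ` satisfy, for every
`α ≠ 0` and every admissible pair `(Θ,Ψ)` (writing `c_l = Θ_l + iΨ_l`),
`Σ_v e(v)(g₂(v)c₃ − g₃(v)c₂) = 0` and `Σ_v e(v)(g₃(v)c₁ − g₁(v)c₃) = 0`,
then `g₁ = g₂ = g₃ = 0`. -/
theorem components_eq_zero_of_curl_exponential_sums
    (g₁ g₂ g₃ : (Fin 3 → ℝ) → ℝ)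
    (h₁ : (Function.support g₁).Finite)
    (h₂ : (Function.support g₂).Finite)
    (h₃ : (Function.support g₃).Finite)
    (hsum : ∀ (α : ℝ), α ≠ 0 → ∀ Θ Ψ : Fin 3 → ℝ, Admissible Θ Ψ →
      (∑ᶠ v : Fin 3 → ℝ,
        Complex.exp (((α * ∑ l, Θ l * v l : ℝ) : ℂ)
            + ((α * ∑ l, Ψ l * v l : ℝ) : ℂ) * Complex.I) *
          ((g₂ v : ℂ) * ((Θ 2 : ℂ) + Ψ 2 * Complex.I)
            - (g₃ v : ℂ) * ((Θ 1 : ℂ) + Ψ 1 * Complex.I)) = 0) ∧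
      (∑ᶠ v : Fin 3 → ℝ,
        Complex.exp (((α * ∑ l, Θ l * v l : ℝ) : ℂ)
            + ((α * ∑ l, Ψ l * v l : ℝ) : ℂ) * Complex.I) *
          ((g₃ v : ℂ) * ((Θ 0 : ℂ) + Ψ 0 * Complex.I)
            - (g₁ v : ℂ) * ((Θ 2 : ℂ) + Ψ 2 * Complex.I)) = 0)) :
    g₁ = 0 ∧ g₂ = 0 ∧ g₃ = 0 := by
  classical
  set s : Finset (Fin 3 → ℝ) := h₁.toFinset ∪ h₂.toFinset ∪ h₃.toFinset with hs
  have hs0 : ∀ v, v ∉ s → g₁ v = 0 ∧ g₂ v = 0 ∧ g₃ v = 0 := by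
    intro v hv
    simpa [hs, not_or, and_assoc] using hv
  obtain ⟨Θ, Ψ, hadm, hsep⟩ := exists_admissible_forall_ne_zero
    (s.offDiag.image fun p => p.1 - p.2) (Finset.finite_toSet _) (by
      simp only [Finset.coe_image, Set.mem_image, Finset.mem_coe, Finset.mem_offDiag, sub_eq_zero]
      rintro ⟨p, ⟨-, -, hne⟩, heq⟩
      exact hne heq)
  set z : (Fin 3 → ℝ) → ℂ := fun v =>
    ((∑ l, Θ l * v l : ℝ) : ℂ) + ((∑ l, Ψ l * v l : ℝ) : ℂ) * Complex.I with hz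
  have hinj : Set.InjOn z s := by
    intro v hv w hw hvw
    by_contra hne
    have hre : ∑ l, Θ l * v l = ∑ l, Θ l * w l := by
      simpa only [hz, Complex.add_re, Complex.re_ofReal_mul, Complex.I_re, mul_zero, add_zero,
        Complex.ofReal_re] using congrArg Complex.re hvw
    have him : ∑ l, Ψ l * v l = ∑ l, Ψ l * w l := by
      simpa only [hz, Complex.add_im, Complex.im_ofReal_mul, Complex.I_im, mul_one, zero_add,
        Complex.ofReal_im] using congrArg Complex.im hvw
    refine hsep (v - w) ?_ ⟨?_, ?_⟩
    · exact Finset.mem_coe.2 (Finset.mem_image.2 ⟨(v, w), Finset.mem_offDiag.2 ⟨hv, hw, hne⟩, rfl⟩)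
    · simp [mul_sub, Finset.sum_sub_distrib, hre]
    · simp [mul_sub, Finset.sum_sub_distrib, him]
  have hexp (α : ℝ) (v : Fin 3 → ℝ) : ((α * ∑ l, Θ l * v l : ℝ) : ℂ)
      + ((α * ∑ l, Ψ l * v l : ℝ) : ℂ) * Complex.I = (α : ℂ) * z v := by
    rw [hz, Complex.ofReal_mul, Complex.ofReal_mul]
    ring
  have hcoeff (k : (Fin 3 → ℝ) → ℂ) (hk : ∀ v, v ∉ s → k v = 0)
      (h : ∀ α : ℝ, α ≠ 0 → ∑ᶠ v, Complex.exp (((α * ∑ l, Θ l * v l : ℝ) : ℂ)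
        + ((α * ∑ l, Ψ l * v l : ℝ) : ℂ) * Complex.I) * k v = 0) : ∀ v ∈ s, k v = 0 := by
    refine eq_zero_of_sum_exp_eq_zero s z k hinj fun α hα => ?_
    have hα' := h α hα
    simp only [hexp] at hα'
    rwa [finsum_eq_sum_of_support_subset (s := s)] at hα'
    intro v hv
    by_contra hvs
    exact hv (by simp [hk v hvs])
  have hzero (v : Fin 3 → ℝ) : g₁ v = 0 ∧ g₂ v = 0 ∧ g₃ v = 0 := by
    by_cases hv : v ∈ s
    · exact hadm.eq_zero_of_parallel
        (hcoeff (fun v => (g₂ v : ℂ) * ((Θ 2 : ℂ) + Ψ 2 * Complex.I)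
            - (g₃ v : ℂ) * ((Θ 1 : ℂ) + Ψ 1 * Complex.I))
          (fun w hw => by simp [hs0 w hw]) (fun α hα => (hsum α hα Θ Ψ hadm).1) v hv)
        (hcoeff (fun v => (g₃ v : ℂ) * ((Θ 0 : ℂ) + Ψ 0 * Complex.I)
            - (g₁ v : ℂ) * ((Θ 2 : ℂ) + Ψ 2 * Complex.I))
          (fun w hw => by simp [hs0 w hw]) (fun α hα => (hsum α hα Θ Ψ hadm).2) v hv)
    · exact hs0 v hv
  exact ⟨funext fun v => (hzero v).1, funext fun v => (hzero v).2.1,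
    funext fun v => (hzero v).2.2⟩
end
end
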